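/- arXiv:2210.14071 — 3 statements merged into one kernel-verified Lean document; each statement's English description precedes it below -/
import Mathlib

section
/- Let m, n, ℓ ∈ ℕ, let V be a relatively open subset of the quadrant Q ⊆ ℝ^m × ℝ^n with 0 ∈ V, and let ψ : V → ℝ^ℓ be stratumwise smooth with 0 as a regular value. Then the set Δ(ψ) = {s : Fin m → Bool | ψ⁻¹(0) ∩ E_s ≠ ∅} is upward-closed for the pointwise order: if s ∈ Δ(ψ) and s ≤ t pointwise, then t ∈ Δ(ψ). -/
/-- The closed quadrant `[0,∞)^m × ℝ^n ⊆ ℝ^m × ℝ^n`. -/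
def quadrant (m n : ℕ) : Set ((Fin m → ℝ) × (Fin n → ℝ)) :=
  {p | ∀ i, 0 ≤ p.1 i}

/-- The stratum `E_s` of the quadrant associated to `s : Fin m → Bool`:
`x i = 0` where `s i = false` and `x i > 0` where `s i = true`. -/
def stratum (m n : ℕ) (s : Fin m → Bool) : Set ((Fin m → ℝ) × (Fin n → ℝ)) :=
  {p | ∀ i, if s i then 0 < p.1 i else p.1 i = 0}

/-- The linear subspace of `ℝ^m × ℝ^n` containing the stratum `E_s`. -/
def stratumSpan (m n : ℕ) (s : Fin m → Bool) :
    Submodule ℝ ((Fin m → ℝ) × (Fin n → ℝ)) where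
  carrier := {p | ∀ i, s i = false → p.1 i = 0}
  add_mem' := by
    intro a b ha hb i hi
    show a.1 i + b.1 i = 0
    rw [ha i hi, hb i hi, add_zero]
  zero_mem' := by
    intro i _
    rfl
  smul_mem' := by
    intro c a ha i hi
    show c * a.1 i = 0
    rw [ha i hi, mul_zero]

open MeasureTheory Metric Set Topology in
theorem bijective_id_add_smul_of_lipschitzWith {E : Type*} [NormedAddCommGroup E] [NormedSpace ℝ E]
    [CompleteSpace E] {φ : E → E} {K : NNReal} (hφ : LipschitzWith K φ) {t : ℝ}
    (ht : ‖t‖₊ * K < 1) : Function.Bijective fun x => x + t • φ x := by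
  have hc (y : E) : ContractingWith (‖t‖₊ * K) fun x => y - t • φ x := by
    refine ⟨ht, LipschitzWith.of_dist_le_mul fun a b => ?_⟩
    rw [dist_sub_left, dist_smul₀, NNReal.coe_mul, coe_nnnorm, mul_assoc]
    gcongr
    exact hφ.dist_le_mul a b
  refine ⟨fun a b hab => (hc (a + t • φ a)).fixedPoint_unique' ?_ ?_, fun y => ?_⟩
  · exact add_sub_cancel_right a _
  · simp only at hab
    exact sub_eq_iff_eq_add.2 hab
  · exact ⟨_, (sub_eq_iff_eq_add.1 ((hc y).fixedPoint_isFixedPt)).symm⟩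

theorem Function.Bijective.image_eq_of_eqOn_compl {α : Type*} {f : α → α} (hf : f.Bijective)
    {s : Set α} (hs : ∀ x ∉ s, f x = x) : f '' s = s := by
  ext y
  constructor
  · rintro ⟨x, hx, rfl⟩
    by_contra h
    exact h ((hf.1 (hs _ h)).symm ▸ hx)
  · intro hy
    obtain ⟨x, rfl⟩ := hf.2 y
    by_cases hx : x ∈ s
    · exact ⟨x, hx, rfl⟩
    · exact absurd (hs x hx ▸ hy) hx

open MeasureTheory Polynomial in
theorem exists_polynomial_eval_eq_setIntegral {X : Type*} [TopologicalSpace X] [MeasurableSpace X]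
    [OpensMeasurableSpace X] [T2Space X] (μ : Measure X) [IsFiniteMeasureOnCompacts μ]
    {K : Set X} (hK : IsCompact K) (p : C(X, ℝ)[X]) :
    ∃ P : ℝ[X], ∀ t, P.eval t =
      ∫ x in K, p.eval₂ (ContinuousMap.evalAlgHom ℝ ℝ x : C(X, ℝ) →+* ℝ) t ∂μ := by
  refine ⟨∑ k ∈ Finset.range (p.natDegree + 1), monomial k (∫ x in K, p.coeff k x ∂μ), fun t => ?_⟩
  simp only [eval_finsetSum, eval_monomial, eval₂_eq_sum_range]
  rw [integral_finsetSum]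
  · simp [integral_mul_const]
  · intro k _
    exact (((p.coeff k).continuous.mul continuous_const).continuousOn.integrableOn_compact hK)

theorem ContinuousLinearMap.det_eq_det_apply_single {ι : Type*} [Fintype ι] [DecidableEq ι]
    (A : (ι → ℝ) →L[ℝ] (ι → ℝ)) :
    A.det = (Matrix.of fun i j => A (Pi.single j 1) i).det := by
  rw [ContinuousLinearMap.det, ← LinearMap.det_toMatrix']
  congr 1

open MeasureTheory Metric Set Topology Polynomial in
/-- The change of variables formula, on a ball, for a map `x ↦ x + φ x` which need not be injective,
and for the test functions `y ↦ (1 - c * ∑ i, y i ^ 2) ^ N`. -/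
theorem setIntegral_det_id_add_fderiv {ι : Type*} [Fintype ι]
    {φ : (ι → ℝ) → (ι → ℝ)} (hφ : ContDiff ℝ 1 φ) {r : ℝ}
    (hr : ∀ x ∉ closedBall (0 : ι → ℝ) r, φ x = 0) (c : ℝ) (N : ℕ) :
    ∫ x in closedBall (0 : ι → ℝ) r, (1 - c * ∑ i, (x i + φ x i) ^ 2) ^ N *
        (ContinuousLinearMap.id ℝ (ι → ℝ) + fderiv ℝ φ x).det =
      ∫ x in closedBall (0 : ι → ℝ) r, (1 - c * ∑ i, x i ^ 2) ^ N := by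
  classical
  set B := closedBall (0 : ι → ℝ) r with hB
  have hBc : IsCompact B := isCompact_closedBall _ _
  have hφ' : Continuous (fderiv ℝ φ) := hφ.continuous_fderiv one_ne_zero
  let a (i j : ι) : C(ι → ℝ, ℝ) := ⟨fun x => fderiv ℝ φ x (Pi.single j 1) i, by fun_prop⟩
  let e (i : ι) : C(ι → ℝ, ℝ) := ⟨fun x => x i, by fun_prop⟩
  have hφc : Continuous φ := hφ.continuous
  let f (i : ι) : C(ι → ℝ, ℝ) := ⟨fun x => φ x i, by fun_prop⟩
  let p : C(ι → ℝ, ℝ)[X] :=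
    (1 - C (algebraMap ℝ _ c) * ∑ i, (C (e i) + X * C (f i)) ^ 2) ^ N *
      (Matrix.of fun i j => C ((1 : Matrix ι ι C(ι → ℝ, ℝ)) i j) + X * C (a i j)).det
  have hp (x : ι → ℝ) (t : ℝ) :
      p.eval₂ (ContinuousMap.evalAlgHom ℝ ℝ x : C(ι → ℝ, ℝ) →+* ℝ) t =
        (1 - c * ∑ i, (x i + t * φ x i) ^ 2) ^ N *
          (ContinuousLinearMap.id ℝ (ι → ℝ) + t • fderiv ℝ φ x).det := by
    rw [← coe_eval₂RingHom, map_mul, RingHom.map_det,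
      ContinuousLinearMap.det_eq_det_apply_single]
    congr 1
    · simp [e, f, eval₂_finsetSum, eval₂_pow, mul_comm t]
    · congr 1
      ext i j
      simp only [RingHom.mapMatrix_apply, Matrix.map_apply, Matrix.of_apply, coe_eval₂RingHom,
        eval₂_add, eval₂_mul, eval₂_C, eval₂_X]
      simp [a, Matrix.one_apply, Pi.single_apply, apply_ite]
  obtain ⟨P, hP⟩ := exists_polynomial_eval_eq_setIntegral volume hBc p
  simp only [hp] at hP
  have hφd : Differentiable ℝ φ := hφ.differentiable one_ne_zero
  have hcs : HasCompactSupport φ := HasCompactSupport.intro hBc hr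
  obtain ⟨K, hK⟩ := hφ.lipschitzWith_of_hasCompactSupport hcs one_ne_zero
  have hsmall : ∀ᶠ t : ℝ in 𝓝 0, ‖t‖₊ * K < 1 := by
    have : Continuous fun t : ℝ => ‖t‖₊ * K := by fun_prop
    exact this.continuousAt.eventually_lt_const (by simp)
  have hpos : ∀ᶠ t : ℝ in 𝓝 0, ∀ x ∈ B,
      0 < (ContinuousLinearMap.id ℝ (ι → ℝ) + t • fderiv ℝ φ x).det := by
    refine hBc.eventually_forall_of_forall_eventually fun x _ => ?_
    have hc : Continuous fun z : ℝ × (ι → ℝ) =>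
        (ContinuousLinearMap.id ℝ (ι → ℝ) + z.1 • fderiv ℝ φ z.2).det := by
      refine ContinuousLinearMap.continuous_det.comp ?_
      fun_prop
    refine hc.continuousAt.eventually_const_lt ?_
    simp [ContinuousLinearMap.det]
  have heq : ∀ᶠ t : ℝ in 𝓝 0, P.eval t = ∫ x in B, (1 - c * ∑ i, x i ^ 2) ^ N := by
    filter_upwards [hsmall, hpos] with t ht htp
    have hbij := bijective_id_add_smul_of_lipschitzWith hK ht
    have himg : (fun x => x + t • φ x) '' B = B :=
      hbij.image_eq_of_eqOn_compl fun x hx => by simp [hr x hx]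
    have key := integral_image_eq_integral_abs_det_fderiv_smul volume (s := B)
      (f := fun x => x + t • φ x)
      (f' := fun x => ContinuousLinearMap.id ℝ (ι → ℝ) + t • fderiv ℝ φ x)
      measurableSet_closedBall
      (fun x _ => ((hasFDerivAt_id x).add
        ((hφd x).hasFDerivAt.const_smul t)).hasFDerivWithinAt)
      hbij.1.injOn (fun x => (1 - c * ∑ i, x i ^ 2) ^ N)
    rw [himg] at key
    rw [key, hP]
    refine setIntegral_congr_fun measurableSet_closedBall fun x hx => ?_
    simp only [smul_eq_mul, abs_of_pos (htp x hx), Pi.add_apply, Pi.smul_apply]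
    ring
  have hconst : P = C (∫ x in B, (1 - c * ∑ i, x i ^ 2) ^ N) := by
    refine P.eq_of_infinite_eval_eq _ ?_
    simp only [eval_C]
    exact infinite_of_mem_nhds 0 heq
  have := hP 1
  rw [hconst, eval_C] at this
  simpa using this.symm

open MeasureTheory Metric Set Topology Filter in
/-- A compactly supported `C^1` perturbation of the identity of `ℝ^ι` vanishes somewhere. -/
theorem exists_add_eq_zero_of_contDiff_of_hasCompactSupport {ι : Type*} [Fintype ι]
    {φ : (ι → ℝ) → (ι → ℝ)} (hφ : ContDiff ℝ 1 φ) (hcs : HasCompactSupport φ) :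
    ∃ x, x + φ x = 0 := by
  obtain ⟨r, hr0, hr⟩ : ∃ r : ℝ, 0 < r ∧ ∀ x ∉ closedBall (0 : ι → ℝ) r, φ x = 0 := by
    obtain ⟨r, hr⟩ := hcs.isCompact.isBounded.subset_closedBall (0 : ι → ℝ)
    refine ⟨max r 1, by positivity, fun x hx => image_eq_zero_of_notMem_tsupport fun h => hx ?_⟩
    exact closedBall_subset_closedBall (le_max_left _ _) (hr h)
  by_contra! hne
  set B := closedBall (0 : ι → ℝ) r with hB
  have hBc : IsCompact B := isCompact_closedBall _ _
  have hφc : Continuous φ := hφ.continuous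
  let q (y : ι → ℝ) : ℝ := ∑ i, y i ^ 2
  have hq : Continuous q := by fun_prop
  have hq0 (y : ι → ℝ) : 0 ≤ q y := by positivity
  have hqpos (y : ι → ℝ) (hy : y ≠ 0) : 0 < q y := by
    refine (hq0 y).lt_of_ne' fun h => hy ?_
    rw [Finset.sum_eq_zero_iff_of_nonneg fun i _ => sq_nonneg _] at h
    ext i
    simpa using h i (Finset.mem_univ i)
  have hg : Continuous fun x => q (x + φ x) := by fun_prop
  obtain ⟨x₀, -, hx₀⟩ := hBc.exists_isMinOn ⟨0, by simp [hB, hr0.le]⟩ hg.continuousOn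
  obtain ⟨M₁, hM₁⟩ := hBc.bddAbove_image hg.continuousOn
  set a := q (x₀ + φ x₀)
  have ha0 : 0 < a := hqpos _ (hne x₀)
  have hM₁' (x) (hx : x ∈ B) : q (x + φ x) ≤ M₁ := hM₁ (mem_image_of_mem _ hx)
  obtain ⟨M₂, hM₂⟩ := hBc.bddAbove_image hq.continuousOn
  have hM₂' (x) (hx : x ∈ B) : q x ≤ M₂ := hM₂ (mem_image_of_mem _ hx)
  obtain ⟨M, hMa, hMM₁, hMM₂⟩ : ∃ M, a ≤ M ∧ M₁ ≤ M ∧ M₂ ≤ M :=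
    ⟨max a (max M₁ M₂), by simp, by simp, by simp⟩
  have hM0 : 0 < M := ha0.trans_le hMa
  have hw (y) : 1 - M⁻¹ * q y = (M - q y) / M := by field_simp
  set β := 1 - M⁻¹ * a with hβ
  set γ := 1 - M⁻¹ * (a / 2) with hγ
  have hβ0 : 0 ≤ β := by rw [hβ, sub_nonneg, inv_mul_le_one₀ hM0]; exact hMa
  have hβγ : β < γ := by
    rw [hβ, hγ]; gcongr; linarith
  have hγ0 : 0 < γ := hβ0.trans_lt hβγ
  let d (x : ι → ℝ) : ℝ := (ContinuousLinearMap.id ℝ (ι → ℝ) + fderiv ℝ φ x).det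
  have hd : Continuous d := by
    have := hφ.continuous_fderiv one_ne_zero
    refine ContinuousLinearMap.continuous_det.comp ?_
    fun_prop
  obtain ⟨D, hD⟩ := hBc.exists_bound_of_continuousOn hd.continuousOn
  let S := B ∩ {y | q y < a / 2}
  have hS : 0 < volume.real S := by
    refine ENNReal.toReal_pos (Measure.measure_pos_of_mem_nhds volume (x := 0) ?_).ne'
      (measure_ne_top_of_subset inter_subset_left hBc.measure_ne_top)
    refine Filter.inter_mem (closedBall_mem_nhds _ hr0) ?_
    exact hq.continuousAt.eventually_lt_const (by simpa [q] using ha0)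
  have hbound (N : ℕ) : γ ^ N * volume.real S ≤ β ^ N * D * volume.real B := by
    have hwc : Continuous fun x => (1 - M⁻¹ * q x) ^ N := by fun_prop
    have hwi := hwc.continuousOn.integrableOn_compact (μ := volume) hBc
    have hSm : MeasurableSet S :=
      measurableSet_closedBall.inter (isOpen_lt hq continuous_const).measurableSet
    calc γ ^ N * volume.real S = ∫ _ in S, γ ^ N := by simp [mul_comm]
      _ ≤ ∫ x in S, (1 - M⁻¹ * q x) ^ N := by
        refine setIntegral_mono_on ?_ (hwi.mono_set inter_subset_left) hSm fun x hx => ?_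
        · exact integrableOn_const (measure_ne_top_of_subset inter_subset_left hBc.measure_ne_top)
        · have : q x ≤ a / 2 := le_of_lt hx.2
          simp only [hγ] at hγ0 ⊢
          gcongr
      _ ≤ ∫ x in B, (1 - M⁻¹ * q x) ^ N := by
        refine setIntegral_mono_set hwi ?_ inter_subset_left.eventuallyLE
        refine (ae_restrict_iff' measurableSet_closedBall).2 (.of_forall fun x hx => ?_)
        refine pow_nonneg ?_ N
        rw [hw]
        exact div_nonneg (sub_nonneg.2 ((hM₂' x hx).trans hMM₂)) hM0.le
      _ = ∫ x in B, (1 - M⁻¹ * q (x + φ x)) ^ N * d x :=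
        (setIntegral_det_id_add_fderiv hφ hr M⁻¹ N).symm
      _ ≤ ‖∫ x in B, (1 - M⁻¹ * q (x + φ x)) ^ N * d x‖ := le_abs_self _
      _ ≤ β ^ N * D * volume.real B := by
        refine norm_setIntegral_le_of_norm_le_const hBc.measure_lt_top fun x hx => ?_
        have h1 : 0 ≤ 1 - M⁻¹ * q (x + φ x) := by
          rw [hw]
          exact div_nonneg (sub_nonneg.2 ((hM₁' x hx).trans hMM₁)) hM0.le
        have h2 : a ≤ q (x + φ x) := hx₀ hx
        rw [norm_mul, norm_pow, Real.norm_of_nonneg h1]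
        gcongr
        · exact sub_le_sub_left (mul_le_mul_of_nonneg_left h2 (inv_nonneg.2 hM0.le)) 1
        · exact hD x hx
  have hlim : Tendsto (fun N : ℕ => (β / γ) ^ N * (D * volume.real B)) atTop (𝓝 0) := by
    simpa using (tendsto_pow_atTop_nhds_zero_of_lt_one (div_nonneg hβ0 hγ0.le)
      ((div_lt_one hγ0).2 hβγ)).mul_const (D * volume.real B)
  refine hS.not_ge (ge_of_tendsto' hlim fun N => ?_)
  rw [div_pow, div_mul_eq_mul_div, le_div_iff₀ (pow_pos hγ0 N), ← mul_assoc, mul_comm _ (γ ^ N)]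
  exact hbound N

open Metric Set Topology Filter in
/-- A map which is `C^1` near a closed ball about `0` and uniformly close to the identity there
has a zero in that ball. -/
theorem exists_mem_closedBall_eq_zero_of_norm_sub_le {ι : Type*} [Fintype ι]
    {F : (ι → ℝ) → (ι → ℝ)} {r : ℝ} (hr : 0 < r)
    (hF : ∀ x ∈ closedBall (0 : ι → ℝ) r, ContDiffAt ℝ 1 F x)
    (hFr : ∀ x ∈ closedBall (0 : ι → ℝ) r, ‖F x - x‖ ≤ r / 2) :
    ∃ x ∈ closedBall (0 : ι → ℝ) r, F x = 0 := by
  let χ : ContDiffBump (0 : ι → ℝ) := ⟨r / 2, r, by positivity, by linarith⟩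
  have hcs : HasCompactSupport fun x => χ x • (F x - x) := χ.hasCompactSupport.smul_right
  have hsm : ContDiff ℝ 1 fun x => χ x • (F x - x) := by
    refine contDiff_iff_contDiffAt.2 fun x => ?_
    by_cases hx : x ∈ closedBall (0 : ι → ℝ) r
    · exact χ.contDiffAt.smul ((hF x hx).sub contDiffAt_id)
    · refine (contDiffAt_const (c := 0)).congr_of_eventuallyEq ?_
      have hx' : x ∉ tsupport χ := by rwa [χ.tsupport_eq]
      filter_upwards [notMem_tsupport_iff_eventuallyEq.1 hx'] with y hy
      simp [hy]
  obtain ⟨x, hx⟩ := exists_add_eq_zero_of_contDiff_of_hasCompactSupport hsm hcs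
  have hxr : x ∈ closedBall (0 : ι → ℝ) r := by
    by_contra h
    rw [mem_closedBall, not_le] at h
    rw [χ.zero_of_le_dist h.le, zero_smul, add_zero] at hx
    rw [hx, dist_self] at h
    exact hr.not_gt h
  have hx2 : x ∈ closedBall (0 : ι → ℝ) (r / 2) := by
    rw [mem_closedBall_zero_iff]
    calc ‖x‖ = ‖χ x • (F x - x)‖ := by rw [← norm_neg x, neg_eq_of_add_eq_zero_right hx]
      _ = χ x * ‖F x - x‖ := by rw [norm_smul, Real.norm_of_nonneg χ.nonneg]
      _ ≤ 1 * (r / 2) := mul_le_mul χ.le_one (hFr x hxr) (norm_nonneg _) zero_le_one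
      _ = r / 2 := one_mul _
  refine ⟨x, hxr, ?_⟩
  rwa [χ.one_of_mem_closedBall hx2, one_smul, add_sub_cancel] at hx

theorem stratum_subset_quadrant {m n : ℕ} (s : Fin m → Bool) :
    stratum m n s ⊆ quadrant m n := by
  intro p hp i
  have := hp i
  split_ifs at this
  exacts [this.le, this.ge]

theorem stratum_subset_stratumSpan {m n : ℕ} (s : Fin m → Bool) :
    stratum m n s ⊆ stratumSpan m n s := by
  intro p hp i hi
  simpa [hi] using hp i

theorem stratumSpan_mono {m n : ℕ} {s t : Fin m → Bool} (hst : s ≤ t) :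
    stratumSpan m n s ≤ stratumSpan m n t := fun _ hp i hi =>
  hp i (Bool.eq_false_of_le_false (hi ▸ hst i))

theorem isOpen_setOf_coe_mem_inter_stratum {m n : ℕ} {U : Set ((Fin m → ℝ) × (Fin n → ℝ))}
    (hU : IsOpen U) (s : Fin m → Bool) :
    IsOpen {p : stratumSpan m n s |
      (p : (Fin m → ℝ) × (Fin n → ℝ)) ∈ (U ∩ quadrant m n) ∩ stratum m n s} := by
  have : {p : stratumSpan m n s |
      (p : (Fin m → ℝ) × (Fin n → ℝ)) ∈ (U ∩ quadrant m n) ∩ stratum m n s} =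
      (↑) ⁻¹' (U ∩ ⋂ i, {p | s i = true → 0 < p.1 i}) := by
    ext p
    simp only [Set.mem_ofPred_eq, Set.mem_preimage, Set.mem_inter_iff, Set.mem_iInter]
    refine ⟨fun h => ⟨h.1.1, fun i hi => by simpa [hi] using h.2 i⟩, fun h => ?_⟩
    have hp : (p : (Fin m → ℝ) × (Fin n → ℝ)) ∈ stratum m n s := by
      intro i
      cases hi : s i
      · simpa using p.2 i hi
      · simpa using h.2 i hi
    exact ⟨⟨h.1, stratum_subset_quadrant s hp⟩, hp⟩
  rw [this]
  refine (hU.inter (isOpen_iInter_of_finite fun i => ?_)).preimage continuous_subtype_val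
  cases s i
  · simp
  · simpa using isOpen_lt continuous_const (by fun_prop)

/-- The vector pointing from the stratum of `s` into that of `t ≥ s`. -/
def stratumDirection (m n : ℕ) (s t : Fin m → Bool) : stratumSpan m n t :=
  ⟨(fun i => if t i = true ∧ s i = false then 1 else 0, 0), fun i hi => by simp [hi]⟩

theorem add_smul_stratumDirection_mem_stratum {m n : ℕ} {s t : Fin m → Bool} (hst : s ≤ t)
    {p : (Fin m → ℝ) × (Fin n → ℝ)} (hp : p ∈ stratum m n s) {ε : ℝ} (hε : 0 < ε) :
    p + ε • (stratumDirection m n s t : (Fin m → ℝ) × (Fin n → ℝ)) ∈ stratum m n t := by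
  intro i
  have h := hp i
  have hi := hst i
  cases hs : s i <;> cases ht : t i
  case true.false => exact absurd (Bool.eq_false_of_le_false (ht ▸ hi)) (by simp [hs])
  all_goals simp_all [stratumDirection]

open Metric Topology Filter in
/-- If `V` is a relatively open subset of the quadrant containing `0` and
`ψ : V → ℝ^ℓ` is stratumwise smooth with `0` as a regular value, then the set
`Δ(ψ) = {s | ψ⁻¹(0) ∩ E_s ≠ ∅}` is upward-closed for the pointwise order on `Fin m → Bool`. -/
theorem stratification_poset_upward_closed
    (m n ℓ : ℕ) (V : Set ((Fin m → ℝ) × (Fin n → ℝ)))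
    (hVopen : ∃ U : Set ((Fin m → ℝ) × (Fin n → ℝ)), IsOpen U ∧ V = U ∩ quadrant m n)
    (h0V : (0 : (Fin m → ℝ) × (Fin n → ℝ)) ∈ V)
    (ψ : ((Fin m → ℝ) × (Fin n → ℝ)) → (Fin ℓ → ℝ))
    (hcont : ContinuousOn ψ V)
    (hsmooth : ∀ s : Fin m → Bool,
      ContDiffOn ℝ (⊤ : ℕ∞)
        (fun p : stratumSpan m n s => ψ (p : (Fin m → ℝ) × (Fin n → ℝ)))
        {p : stratumSpan m n s | (p : (Fin m → ℝ) × (Fin n → ℝ)) ∈ V ∩ stratum m n s})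
    (hreg : ∀ (s : Fin m → Bool) (z : stratumSpan m n s),
      (z : (Fin m → ℝ) × (Fin n → ℝ)) ∈ V ∩ stratum m n s →
      ψ (z : (Fin m → ℝ) × (Fin n → ℝ)) = 0 →
      Function.Surjective
        ⇑(fderivWithin ℝ
            (fun p : stratumSpan m n s => ψ (p : (Fin m → ℝ) × (Fin n → ℝ)))
            {p : stratumSpan m n s | (p : (Fin m → ℝ) × (Fin n → ℝ)) ∈ V ∩ stratum m n s}
            z))
    (s t : Fin m → Bool) (hst : s ≤ t)
    (hs : ∃ p ∈ V ∩ stratum m n s, ψ p = 0) :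
    ∃ p ∈ V ∩ stratum m n t, ψ p = 0 := by
  obtain ⟨U, hU, rfl⟩ := hVopen
  obtain ⟨p, hp, hp0⟩ := hs
  let z : stratumSpan m n s := ⟨p, stratum_subset_stratumSpan s hp.2⟩
  have hSo := isOpen_setOf_coe_mem_inter_stratum hU s
  have hz : z ∈ {p : stratumSpan m n s |
      (p : (Fin m → ℝ) × (Fin n → ℝ)) ∈ (U ∩ quadrant m n) ∩ stratum m n s} := hp
  have hsurj := hreg s z hp hp0
  have hd := ((hsmooth s).differentiableOn (by simp) z hz).hasFDerivWithinAt.hasFDerivAt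
    (hSo.mem_nhds hz)
  obtain ⟨R, hR⟩ := ContinuousLinearMap.exists_rightInverse_of_surjective _
    (LinearMap.range_eq_top.2 hsurj)
  have hF : HasFDerivAt (fun y => ψ (z + R y : stratumSpan m n s))
      (ContinuousLinearMap.id ℝ (Fin ℓ → ℝ)) 0 := by
    rw [← hR]
    rw [← add_zero z, ← map_zero R] at hd
    have hcomp := hd.comp (0 : Fin ℓ → ℝ) (R.hasFDerivAt.const_add z)
    simp only [map_zero, add_zero] at hcomp
    exact hcomp
  obtain ⟨r, hr, hrB⟩ : ∃ r > 0, ∀ y ∈ closedBall (0 : Fin ℓ → ℝ) r,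
      ((z + R y : stratumSpan m n s) : (Fin m → ℝ) × (Fin n → ℝ)) ∈
        (U ∩ quadrant m n) ∩ stratum m n s ∧
      ‖ψ (z + R y : stratumSpan m n s) - y‖ ≤ 1 / 4 * ‖y‖ := by
    refine nhds_basis_closedBall.eventually_iff.1 (.and ?_ ?_)
    · have hc : Continuous fun y => z + R y := by fun_prop
      exact hc.continuousAt.eventually_mem
        (by rw [map_zero, add_zero]; exact hSo.mem_nhds hz)
    · have := (hasFDerivAt_iff_isLittleO_nhds_zero.1 hF).def (c := 1 / 4) (by norm_num)
      simpa [z, hp0] using this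
  let J := (Submodule.inclusion (stratumSpan_mono (n := n) hst)).toContinuousLinearMap
  let G (ε : ℝ) (y : Fin ℓ → ℝ) : stratumSpan m n t :=
    J (z + R y) + ε • stratumDirection m n s t
  have hG : Continuous fun w : ℝ × (Fin ℓ → ℝ) =>
      (G w.1 w.2 : (Fin m → ℝ) × (Fin n → ℝ)) := by
    simp only [G]; fun_prop
  have hG0 (y) : (G 0 y : (Fin m → ℝ) × (Fin n → ℝ)) = (z + R y : stratumSpan m n s) := by
    simp [G, J]
  have hnear : ∀ᶠ ε : ℝ in 𝓝 0, ∀ y ∈ closedBall (0 : Fin ℓ → ℝ) r,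
      (G ε y : (Fin m → ℝ) × (Fin n → ℝ)) ∈ U ∧
      ((G ε y : (Fin m → ℝ) × (Fin n → ℝ)) ∈ U ∩ quadrant m n → ‖ψ (G ε y) - y‖ < r / 2) := by
    refine (isCompact_closedBall _ _).eventually_forall_of_forall_eventually fun y hy => ?_
    have hV := (hrB y hy).1.1
    rw [← hG0] at hV
    refine .and (hG.continuousAt.eventually_mem (hU.mem_nhds hV.1)) ?_
    have hc : ContinuousWithinAt
        (fun w : ℝ × (Fin ℓ → ℝ) => ‖ψ (G w.1 w.2 : (Fin m → ℝ) × (Fin n → ℝ)) - w.2‖)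
        ((fun w : ℝ × (Fin ℓ → ℝ) => (G w.1 w.2 : (Fin m → ℝ) × (Fin n → ℝ))) ⁻¹'
          (U ∩ quadrant m n)) (0, y) :=
      (((hcont _ hV).comp (x := ((0 : ℝ), y)) hG.continuousWithinAt
        (Set.mapsTo_preimage _ _)).sub continuous_snd.continuousWithinAt).norm
    refine eventually_nhdsWithin_iff.1 (hc.eventually_lt_const ?_)
    have h4 := (hrB y hy).2
    rw [mem_closedBall_zero_iff] at hy
    simp only [hG0]
    linarith
  obtain ⟨ε, hε, hε0⟩ := ((hnear.filter_mono nhdsWithin_le_nhds).and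
    (self_mem_nhdsWithin (s := Set.Ioi (0 : ℝ)))).exists
  have hGt (y) (hy : y ∈ closedBall (0 : Fin ℓ → ℝ) r) :
      (G ε y : (Fin m → ℝ) × (Fin n → ℝ)) ∈ (U ∩ quadrant m n) ∩ stratum m n t := by
    have : (G ε y : (Fin m → ℝ) × (Fin n → ℝ)) ∈ stratum m n t :=
      add_smul_stratumDirection_mem_stratum hst (hrB y hy).1.2 hε0
    exact ⟨⟨(hε y hy).1, stratum_subset_quadrant t this⟩, this⟩
  have hGs : ContDiff ℝ 1 (G ε) := by
    simp only [G]; fun_prop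
  obtain ⟨y, hy, hy0⟩ := exists_mem_closedBall_eq_zero_of_norm_sub_le
    (F := fun y => ψ (G ε y)) hr
    (fun y hy => (((hsmooth t).contDiffAt
      ((isOpen_setOf_coe_mem_inter_stratum hU t).mem_nhds (hGt y hy))).of_le
        (by exact_mod_cast le_top)).comp y hGs.contDiffAt)
    (fun y hy => ((hε y hy).2 (hGt y hy).1).le)
  exact ⟨G ε y, hGt y hy, hy0⟩
end

section
/- Let N, ℓ be integers with 1 ≤ ℓ ≤ N, let U ⊆ ℝ^N be open, let ψ : U → ℝ^ℓ be smooth, and let z ∈ U satisfy ψ(z) = 0 with the derivative Dψ(z) : ℝ^N → ℝ^ℓ surjective. Then for every ε > 0 there exists a continuous map c : S^{ℓ−1} → U whose image lies in the open ball of radius ε about z and is disjoint from ψ⁻¹(0), such that the composite x ↦ ψ(c(x)), viewed as a continuous map S^{ℓ−1} → ℝ^ℓ \ {0}, is not null-homotopic. -/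
section

open MeasureTheory Metric Set Filter Topology Polynomial
open scoped NNReal

section LagrangeDeterminant

variable {V : Type*} [AddCommGroup V] [Module ℝ V]

theorem exists_weights_det_id_add_smul [FiniteDimensional ℝ V] (τ : ℝ) (hτ : 0 < τ) :
    ∃ (v w : Fin (Module.finrank ℝ V + 1) → ℝ), (∀ i, 0 < v i ∧ v i ≤ τ) ∧ ∑ i, w i = 1 ∧
      ∀ A : V →ₗ[ℝ] V, LinearMap.det (LinearMap.id + A) =
        ∑ i, w i * LinearMap.det (LinearMap.id + v i • A) := by
  set n := Module.finrank ℝ V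
  set v : Fin (n + 1) → ℝ := fun i => τ / (i + 1) with hv
  have hinj : Set.InjOn v (Finset.univ : Finset (Fin (n + 1))) := by
    intro i _ j _ hij
    have hi : (0 : ℝ) < (i : ℝ) + 1 := by positivity
    have hj : (0 : ℝ) < (j : ℝ) + 1 := by positivity
    simp only [hv] at hij
    rw [div_eq_div_iff hi.ne' hj.ne'] at hij
    have := mul_left_cancel₀ hτ.ne' hij
    apply Fin.ext
    have h : (j : ℝ) = i := by linarith
    exact_mod_cast h.symm
  refine ⟨v, fun i => (Lagrange.basis Finset.univ v i).eval 1, fun i => ⟨by positivity, ?_⟩, ?_, ?_⟩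
  · exact div_le_self hτ.le (by linarith [Nat.cast_nonneg (α := ℝ) (i : ℕ)])
  · rw [← eval_finsetSum, Lagrange.sum_basis hinj Finset.univ_nonempty, eval_one]
  · intro A
    let b := Module.finBasis ℝ V
    let M := LinearMap.toMatrix b b A
    let p : ℝ[X] := Matrix.det ((X : ℝ[X]) • M.map C + (1 : Matrix _ _ ℝ).map C)
    have hp : ∀ t : ℝ, p.eval t = LinearMap.det (LinearMap.id + t • A) := by
      intro t
      rw [← LinearMap.det_toMatrix b, ← coe_evalRingHom, RingHom.map_det]
      have h : LinearMap.toMatrix b b (LinearMap.id + t • A) = 1 + t • M := by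
        rw [map_add, map_smul, LinearMap.toMatrix_id]
      rw [h, add_comm (1 : Matrix _ _ ℝ)]
      congr 1
      ext i j
      by_cases hij : i = j <;> simp [hij, mul_comm t]
    have hdeg : p.degree < (Finset.univ : Finset (Fin (n + 1))).card := by
      refine lt_of_le_of_lt degree_le_natDegree ?_
      have := natDegree_det_X_add_C_le M 1
      simp only [Fintype.card_fin, Finset.card_univ] at this ⊢
      exact_mod_cast Nat.lt_succ_of_le this
    have key := congrArg (eval (1 : ℝ)) (Lagrange.eq_interpolate hinj hdeg)
    rw [hp, one_smul, Lagrange.interpolate_apply, eval_finsetSum] at key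
    rw [key]
    refine Finset.sum_congr rfl fun i _ => ?_
    rw [eval_mul, eval_C, hp, mul_comm]

end LagrangeDeterminant

section NoRetraction

variable {E : Type*} [NormedAddCommGroup E]

theorem LipschitzOnWith.exists_lipschitzWith_zero_outside_closedBall [NormedSpace ℝ E]
    {g : E → E} {R : ℝ} {K : ℝ≥0} (hR : 0 < R) (hg : LipschitzOnWith K g (closedBall 0 R))
    (h0 : ∀ x, ‖x‖ = R → g x = 0) :
    ∃ g' : E → E, (∀ x ∈ closedBall 0 R, g' x = g x) ∧ (∀ x, R ≤ ‖x‖ → g' x = 0) ∧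
      LipschitzWith (2 * K) g' := by
  classical
  have cross : ∀ x y : E, ‖x‖ ≤ R → R < ‖y‖ → ‖g x‖ ≤ 2 * K * ‖x - y‖ := by
    intro x y hx hy
    have hy0 : 0 < ‖y‖ := hR.trans hy
    have hnorm : ‖(R / ‖y‖) • y‖ = R := by
      rw [norm_smul, Real.norm_of_nonneg (by positivity), div_mul_cancel₀ _ hy0.ne']
    have h1 := hg.norm_sub_le (mem_closedBall_zero_iff.2 hx) (mem_closedBall_zero_iff.2 hnorm.le)
    rw [h0 _ hnorm, sub_zero] at h1
    have h2 : ‖y - (R / ‖y‖) • y‖ = ‖y‖ - R := by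
      have : y - (R / ‖y‖) • y = (1 - R / ‖y‖) • y := by rw [sub_smul, one_smul]
      rw [this, norm_smul, Real.norm_of_nonneg (sub_nonneg.2 ((div_le_one hy0).2 hy.le))]
      field_simp
    have h3 : ‖y‖ - ‖x‖ ≤ ‖x - y‖ := by
      rw [norm_sub_rev]; exact norm_sub_norm_le y x
    have h4 : ‖x - (R / ‖y‖) • y‖ ≤ ‖x - y‖ + ‖y - (R / ‖y‖) • y‖ :=
      norm_sub_le_norm_sub_add_norm_sub _ _ _
    have h5 : ‖x - (R / ‖y‖) • y‖ ≤ 2 * ‖x - y‖ := by linarith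
    calc ‖g x‖ ≤ K * ‖x - (R / ‖y‖) • y‖ := h1
      _ ≤ K * (2 * ‖x - y‖) := by gcongr
      _ = _ := by ring
  refine ⟨fun x => if ‖x‖ ≤ R then g x else 0, fun x hx => if_pos (mem_closedBall_zero_iff.1 hx),
    fun x hx => ?_, LipschitzWith.of_dist_le_mul fun x y => ?_⟩
  · by_cases h : ‖x‖ ≤ R
    · simp only [if_pos h, h0 x (le_antisymm h hx)]
    · simp only [if_neg h]
  · rw [dist_eq_norm, dist_eq_norm]
    push_cast
    by_cases hx : ‖x‖ ≤ R <;> by_cases hy : ‖y‖ ≤ R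
    · simp only [if_pos hx, if_pos hy]
      have := hg.norm_sub_le (mem_closedBall_zero_iff.2 hx) (mem_closedBall_zero_iff.2 hy)
      have h' : 0 ≤ K * ‖x - y‖ := by positivity
      linarith
    · simpa only [if_pos hx, if_neg hy, sub_zero] using cross x y hx (not_le.1 hy)
    · simpa only [if_neg hx, if_pos hy, zero_sub, norm_neg, norm_sub_rev x y] using
        cross y x hy (not_le.1 hx)
    · simp only [if_neg hx, if_neg hy, sub_zero, norm_zero]
      positivity

theorem bijective_add_of_lipschitzWith [NormedSpace ℝ E] [CompleteSpace E] {g : E → E} {c : ℝ≥0}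
    (hg : LipschitzWith c g) (hc : c < 1) : Function.Bijective fun x => x + g x := by
  have happ : ApproximatesLinearOn (fun x => x + g x)
      ((ContinuousLinearEquiv.refl ℝ E : E ≃L[ℝ] E) : E →L[ℝ] E) univ c := by
    apply LipschitzOnWith.approximatesLinearOn
    convert hg.lipschitzOnWith (s := univ) using 1
    ext x
    simp
  have hN : Subsingleton E ∨
      c < ‖((ContinuousLinearEquiv.refl ℝ E).symm : E →L[ℝ] E)‖₊⁻¹ := by
    rcases subsingleton_or_nontrivial E with h | h
    · exact Or.inl h
    · right
      have : ‖((ContinuousLinearEquiv.refl ℝ E).symm : E →L[ℝ] E)‖₊ = 1 := by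
        ext
        exact ContinuousLinearMap.norm_id
      rwa [this, inv_one]
  exact ⟨injOn_univ.1 (happ.injOn hN), happ.surjective hN⟩

theorem image_ball_add_of_lipschitzWith [NormedSpace ℝ E] [CompleteSpace E] {g : E → E} {c : ℝ≥0}
    {R : ℝ} (hg : LipschitzWith c g) (hc : c < 1) (h0 : ∀ x, R ≤ ‖x‖ → g x = 0) :
    (fun x => x + g x) '' ball 0 R = ball 0 R := by
  have hb := bijective_add_of_lipschitzWith hg hc
  have hfix : ∀ x, R ≤ ‖x‖ → x + g x = x := fun x hx => by rw [h0 x hx, add_zero]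
  apply Subset.antisymm
  · rintro _ ⟨x, hx, rfl⟩
    rw [mem_ball_zero_iff] at hx ⊢
    by_contra! h
    have := hb.1 (show (fun x => x + g x) (x + g x) = (fun x => x + g x) x from hfix _ h)
    rw [this] at h
    linarith
  · intro y hy
    obtain ⟨x, hx⟩ := hb.2 y
    refine ⟨x, ?_, hx⟩
    rw [mem_ball_zero_iff] at hy ⊢
    by_contra! h
    simp only [hfix x h] at hx
    rw [← hx] at hy
    linarith

variable [InnerProductSpace ℝ E] [FiniteDimensional ℝ E]

/-- The Jacobian determinant of a `C¹` perturbation of the identity which fixes the boundary sphere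
integrates to the volume of the ball. -/
theorem setIntegral_det_id_add_fderiv_s1 [MeasurableSpace E] [BorelSpace E]
    (μ : Measure E) [μ.IsAddHaarMeasure] {g : E → E} {R : ℝ} (hR : 0 < R)
    (hg : ContDiff ℝ 1 g) (h0 : ∀ x, ‖x‖ = R → g x = 0) :
    ∫ x in ball 0 R, (ContinuousLinearMap.id ℝ E + fderiv ℝ g x).det ∂μ = μ.real (ball 0 R) := by
  obtain ⟨K, hK⟩ :=
    hg.locallyLipschitz.locallyLipschitzOn.exists_lipschitzOnWith_of_compact
      (isCompact_closedBall (0 : E) R)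
  obtain ⟨g', hgg', hg'0, hg'L⟩ := hK.exists_lipschitzWith_zero_outside_closedBall hR h0
  have hdg : ∀ x, HasFDerivAt g (fderiv ℝ g x) x := fun x =>
    (hg.differentiable one_ne_zero x).hasFDerivAt
  have hcont : Continuous (fderiv ℝ g) := hg.continuous_fderiv one_ne_zero
  have hdetcont : ∀ t : ℝ, Continuous fun x =>
      (ContinuousLinearMap.id ℝ E + t • fderiv ℝ g x).det := fun t =>
    ContinuousLinearMap.continuous_det.comp (by fun_prop)
  obtain ⟨C, hC0, hC⟩ : ∃ C > 0, ∀ x ∈ closedBall (0 : E) R, ‖fderiv ℝ g x‖ ≤ C := by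
    obtain ⟨C, hC⟩ := (isCompact_closedBall (0 : E) R).exists_bound_of_continuousOn
      hcont.continuousOn
    exact ⟨max C 1, by positivity, fun x hx => (hC x hx).trans (le_max_left _ _)⟩
  obtain ⟨δ, hδ, hdet⟩ : ∃ δ > 0, ∀ B : E →L[ℝ] E, ‖B‖ < δ →
      0 < (ContinuousLinearMap.id ℝ E + B).det := by
    have hc : ContinuousAt (fun B : E →L[ℝ] E => (ContinuousLinearMap.id ℝ E + B).det) 0 :=
      (ContinuousLinearMap.continuous_det.comp (by fun_prop)).continuousAt
    have h1 : (0 : ℝ) < (fun B : E →L[ℝ] E => (ContinuousLinearMap.id ℝ E + B).det) 0 := by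
      simp [ContinuousLinearMap.det]
    obtain ⟨δ, hδ, h⟩ := Metric.eventually_nhds_iff.1 (hc.eventually_const_lt h1)
    exact ⟨δ, hδ, fun B hB => h (by simpa using hB)⟩
  have hvol : ∀ t : ℝ, 0 < t → t * (2 * K) < 1 → t * C < δ →
      ∫ x in ball 0 R, (ContinuousLinearMap.id ℝ E + t • fderiv ℝ g x).det ∂μ =
        μ.real (ball 0 R) := by
    intro t ht htK htC
    have hL : LipschitzWith (t.toNNReal * (2 * K)) fun x => t • g' x := by
      refine LipschitzWith.of_dist_le_mul fun x y => ?_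
      have := hg'L.dist_le_mul x y
      rw [dist_smul₀, Real.norm_of_nonneg ht.le]
      push_cast at this ⊢
      rw [Real.coe_toNNReal _ ht.le, mul_assoc t]
      gcongr
    have hL1 : t.toNNReal * (2 * K) < 1 := by
      rw [← NNReal.coe_lt_coe]
      push_cast
      rwa [Real.coe_toNNReal _ ht.le]
    have himg := image_ball_add_of_lipschitzWith (R := R) hL hL1 fun x hx => by
      rw [hg'0 x hx, smul_zero]
    have hinj := (bijective_add_of_lipschitzWith hL hL1).1
    have hder : ∀ x ∈ ball (0 : E) R, HasFDerivWithinAt (fun x => x + t • g' x)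
        (ContinuousLinearMap.id ℝ E + t • fderiv ℝ g x) (ball 0 R) x := by
      intro x hx
      have h : HasFDerivWithinAt (fun x => x + t • g x)
          (ContinuousLinearMap.id ℝ E + t • fderiv ℝ g x) (ball 0 R) x :=
        ((hasFDerivAt_id x).add ((hdg x).const_smul t)).hasFDerivWithinAt
      exact h.congr (fun y hy => by rw [hgg' y (ball_subset_closedBall hy)])
        (by rw [hgg' x (ball_subset_closedBall hx)])
    have hcv := integral_image_eq_integral_abs_det_fderiv_smul μ measurableSet_ball hder
      hinj.injOn (fun _ => (1 : ℝ))
    rw [himg] at hcv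
    simp only [smul_eq_mul, mul_one, integral_const, measureReal_restrict_apply_univ] at hcv
    rw [hcv]
    refine setIntegral_congr_fun measurableSet_ball fun x hx => ?_
    refine (abs_of_pos (hdet _ ?_)).symm
    rw [norm_smul, Real.norm_of_nonneg ht.le]
    exact (mul_le_mul_of_nonneg_left (hC x (ball_subset_closedBall hx)) ht.le).trans_lt htC
  obtain ⟨τ, hτ, hτK, hτC⟩ : ∃ τ : ℝ, 0 < τ ∧ τ * (2 * K) < 1 ∧ τ * C < δ := by
    have h1 : ∀ᶠ τ : ℝ in 𝓝 0, τ * (2 * K) < 1 :=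
      (Continuous.tendsto' (by fun_prop) 0 0 (by simp) :
        Tendsto (fun τ : ℝ => τ * (2 * K)) (𝓝 0) (𝓝 0)).eventually_lt_const one_pos
    have h2 : ∀ᶠ τ : ℝ in 𝓝 0, τ * C < δ :=
      (Continuous.tendsto' (by fun_prop) 0 0 (by simp) :
        Tendsto (fun τ : ℝ => τ * C) (𝓝 0) (𝓝 0)).eventually_lt_const hδ
    obtain ⟨τ, ⟨h1, h2⟩, h3⟩ := (((h1.and h2).filter_mono nhdsWithin_le_nhds).and
      (self_mem_nhdsWithin (s := Ioi (0 : ℝ)))).exists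
    exact ⟨τ, h3, h1, h2⟩
  obtain ⟨v, w, hv, hw, hvw⟩ := exists_weights_det_id_add_smul (V := E) τ hτ
  have hsum : ∀ x, (ContinuousLinearMap.id ℝ E + fderiv ℝ g x).det =
      ∑ i, w i * (ContinuousLinearMap.id ℝ E + v i • fderiv ℝ g x).det := fun x =>
    hvw (fderiv ℝ g x : E →ₗ[ℝ] E)
  simp_rw [hsum]
  rw [integral_finsetSum]
  · have : ∀ i, ∫ x in ball 0 R, w i * (ContinuousLinearMap.id ℝ E + v i • fderiv ℝ g x).det ∂μ =
        w i * μ.real (ball 0 R) := by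
      intro i
      rw [integral_const_mul, hvol (v i) (hv i).1]
      · exact (mul_le_mul_of_nonneg_right (hv i).2 (by positivity)).trans_lt hτK
      · exact (mul_le_mul_of_nonneg_right (hv i).2 hC0.le).trans_lt hτC
    simp_rw [this]
    rw [← Finset.sum_mul, hw, one_mul]
  · intro i _
    exact ((continuous_const.mul (hdetcont (v i))).continuousOn.integrableOn_compact
      (isCompact_closedBall (0 : E) R)).mono_set ball_subset_closedBall

/-- There is no `C¹` retraction of a ball onto its boundary sphere. -/
theorem not_exists_contDiff_retraction {r : E → E} {R : ℝ} (hR : 0 < R) (hr : ContDiff ℝ 1 r)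
    (hnorm : ∀ x, ‖r x‖ = R) (hfix : ∀ x, ‖x‖ = R → r x = x) : False := by
  borelize E
  have h := setIntegral_det_id_add_fderiv_s1 (Measure.addHaar : Measure E) hR (g := fun x => r x - x)
    (hr.sub contDiff_id) fun x hx => by rw [hfix x hx, sub_self]
  have hdet : ∀ x, (ContinuousLinearMap.id ℝ E + fderiv ℝ (fun x => r x - x) x).det = 0 := by
    intro x
    have hrx := (hr.differentiable one_ne_zero x).hasFDerivAt
    have hsub : fderiv ℝ (fun x => r x - x) x = fderiv ℝ r x - ContinuousLinearMap.id ℝ E :=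
      (hrx.sub (hasFDerivAt_id x)).fderiv
    rw [hsub, add_sub_cancel]
    by_contra hne
    have hort : ∀ v, inner ℝ (r x) (fderiv ℝ r x v) = 0 := by
      intro v
      have h1 := hrx.norm_sq
      have h2 : HasFDerivAt (fun y => ‖r y‖ ^ 2) (0 : E →L[ℝ] ℝ) x := by
        simp_rw [hnorm]
        exact hasFDerivAt_const _ _
      have h3 := congrArg (fun L : E →L[ℝ] ℝ => L v) (h1.unique h2)
      simpa using h3
    have hsurj : Function.Surjective (fderiv ℝ r x) :=
      (LinearMap.equivOfDetNeZero (fderiv ℝ r x : E →ₗ[ℝ] E) hne).surjective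
    obtain ⟨v, hv⟩ := hsurj (r x)
    have := hort v
    rw [hv, inner_self_eq_zero] at this
    have h' := hnorm x
    rw [this, norm_zero] at h'
    linarith
  simp_rw [hdet, integral_zero] at h
  have : 0 < (Measure.addHaar : Measure E).real (ball 0 R) :=
    ENNReal.toReal_pos (measure_ball_pos _ _ hR).ne' measure_ball_lt_top.ne
  linarith

/-- A continuous nowhere-vanishing vector field cannot be radial outside the unit ball. -/
theorem not_exists_continuous_ne_zero_extension {F : E → E} (hF : Continuous F)
    (hne : ∀ x, F x ≠ 0) (hrad : ∀ x, 1 ≤ ‖x‖ → F x = ‖x‖⁻¹ • x) : False := by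
  have hsmooth : ContDiffOn ℝ ((1 : ℕ∞) : WithTop ℕ∞) F (closedBall (0 : E) 1)ᶜ := by
    have hnz : ∀ x ∈ (closedBall (0 : E) 1)ᶜ, 1 < ‖x‖ := fun x hx => by simpa using hx
    refine ContDiffOn.congr (f := fun x => ‖x‖⁻¹ • x) ?_ fun x hx => hrad x (hnz x hx).le
    intro x hx
    have hx0 : x ≠ 0 := norm_pos_iff.1 (one_pos.trans (hnz x hx))
    exact (((contDiffAt_norm ℝ hx0).inv (norm_ne_zero_iff.2 hx0)).smul
      contDiffAt_id).contDiffWithinAt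
  obtain ⟨G, hG, hGF, hGeq, -⟩ := hF.exists_contDiff_approx_and_eqOn 1 hF.norm
    (fun x => norm_pos_iff.2 (hne x)) (S := (ball (0 : E) 2)ᶜ) isOpen_ball.isClosed_compl
    (isClosed_closedBall.isOpen_compl.mem_nhdsSet.2 (by
      intro x hx
      simp only [mem_compl_iff, mem_ball_zero_iff, mem_closedBall_zero_iff, not_lt, not_le] at hx ⊢
      linarith)) hsmooth
  have hG0 : ∀ x, G x ≠ 0 := by
    intro x hx
    have := hGF x
    rw [hx, dist_zero_left] at this
    exact lt_irrefl _ this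
  refine not_exists_contDiff_retraction (r := fun x => (2 * ‖G x‖⁻¹) • G x) (R := 2) two_pos
    ?_ ?_ ?_
  · exact (contDiff_const.mul ((hG.norm ℝ hG0).inv fun x => norm_ne_zero_iff.2 (hG0 x))).smul hG
  · intro x
    rw [norm_smul, norm_mul, norm_inv, norm_norm, mul_assoc,
      inv_mul_cancel₀ (norm_ne_zero_iff.2 (hG0 x))]
    simp
  · intro x hx
    have h : G x = (2 : ℝ)⁻¹ • x := by
      rw [hGeq (by simp [hx]), hrad x (by rw [hx]; norm_num), hx]
    simp only [h, norm_smul, hx, smul_smul]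
    norm_num

end NoRetraction

section Linking

variable {E : Type*} [NormedAddCommGroup E] [InnerProductSpace ℝ E] [FiniteDimensional ℝ E]

/-- The inclusion of the unit sphere into the punctured space is not null-homotopic. -/
theorem not_nullhomotopic_of_coe_eq (ι : C(sphere (0 : E) 1, {y : E // y ≠ 0}))
    (hι : ∀ x, (ι x : E) = x) : ¬ ι.Nullhomotopic := by
  classical
  rintro ⟨y, ⟨H⟩⟩
  let u : {x : E // x ≠ 0} → sphere (0 : E) 1 := fun x => ⟨‖(x : E)‖⁻¹ • (x : E), by
    rw [mem_sphere_zero_iff_norm, norm_smul, norm_inv, norm_norm,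
      inv_mul_cancel₀ (norm_ne_zero_iff.2 x.2)]⟩
  have hu : Continuous u := by
    refine Continuous.subtype_mk (Continuous.smul (Continuous.inv₀ (by fun_prop) fun x =>
      norm_ne_zero_iff.2 x.2) continuous_subtype_val) _
  let s : E → unitInterval := fun x => projIcc 0 1 zero_le_one (2 - 2 * ‖x‖)
  have hs : Continuous s := continuous_projIcc.comp (by fun_prop)
  let F' : {x : E // x ≠ 0} → E := fun x => (H (s x, u x) : E)
  have hF' : Continuous F' := by
    have : Continuous fun x : {x : E // x ≠ 0} => (s x, u x) := by fun_prop
    exact continuous_subtype_val.comp (H.continuous.comp this)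
  let F : E → E := fun x => if h : x ≠ 0 then F' ⟨x, h⟩ else y
  have hFsmall : ∀ x, ‖x‖ < 1 / 2 → F x = y := by
    intro x hx
    by_cases h : x ≠ 0
    · have : s x = 1 := projIcc_of_right_le _ (by linarith)
      simp only [F, dif_pos h, F', this, H.apply_one, ContinuousMap.const_apply]
    · simp only [F, dif_neg h]
  refine not_exists_continuous_ne_zero_extension (F := F) ?_ ?_ ?_
  · rw [continuous_iff_continuousAt]
    intro x
    by_cases h : x ≠ 0
    · have hopen : IsOpen {x : E | x ≠ 0} := isOpen_ne
      have hon : ContinuousOn F {x : E | x ≠ 0} := by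
        rw [continuousOn_iff_continuous_domRestrict]
        exact hF'.congr fun z => by simp only [domRestrict_apply, F, dif_pos z.2]
      exact hon.continuousAt (hopen.mem_nhds h)
    · have hx : x ∈ ball (0 : E) (1 / 2) := by
        rw [not_not.1 h]; exact mem_ball_self (by norm_num)
      refine (continuousAt_const (y := (y : E))).congr ?_
      filter_upwards [isOpen_ball.mem_nhds hx] with z hz
      exact (hFsmall z (mem_ball_zero_iff.1 hz)).symm
  · intro x
    by_cases h : x ≠ 0
    · simp only [F, dif_pos h]
      exact (H _).2
    · simp only [F, dif_neg h]
      exact y.2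
  · intro x hx
    have h : x ≠ 0 := norm_pos_iff.1 (one_pos.trans_le hx)
    have : s x = 0 := projIcc_of_le_left _ (by linarith)
    simp only [F, dif_pos h, F', this, H.apply_zero, hι, u]

theorem not_nullhomotopic_of_norm_sub_smul_lt (g : C(sphere (0 : E) 1, {y : E // y ≠ 0})) {δ : ℝ}
    (hδ : 0 < δ) (hg : ∀ x, ‖(g x : E) - δ • (x : E)‖ < δ) : ¬ g.Nullhomotopic := by
  rintro ⟨y, hy⟩
  let ι : C(sphere (0 : E) 1, {y : E // y ≠ 0}) :=
    ⟨fun x => ⟨x, ne_zero_of_mem_unit_sphere x⟩, by fun_prop⟩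
  refine not_nullhomotopic_of_coe_eq ι (fun _ => rfl) ⟨y, ContinuousMap.Homotopic.trans ⟨?_⟩ hy⟩
  refine
    { toFun := fun p => ⟨(1 - (p.1 : ℝ)) • (p.2 : E) + (p.1 : ℝ) • (g p.2 : E), ?_⟩
      continuous_toFun := ?_
      map_zero_left := fun x => by simp [ι]
      map_one_left := fun x => by simp }
  · obtain ⟨⟨t, ht0, ht1⟩, x⟩ := p
    intro h0
    simp only at h0
    have hx : ‖(x : E)‖ = 1 := mem_sphere_zero_iff_norm.1 x.2
    have h1 : (1 - t + t * δ) • (x : E) = -(t • ((g x : E) - δ • (x : E))) := by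
      rw [eq_neg_iff_add_eq_zero]
      refine Eq.trans ?_ h0
      module
    have h2 := congrArg norm h1
    have hpos : 0 < 1 - t + t * δ := by
      rcases ht1.lt_or_eq with h | h
      · have : 0 ≤ t * δ := by positivity
        linarith
      · rw [h]; linarith
    rw [norm_smul, hx, mul_one, norm_neg, norm_smul, Real.norm_of_nonneg ht0,
      Real.norm_of_nonneg hpos.le] at h2
    rcases ht0.lt_or_eq with h | h
    · have := mul_lt_mul_of_pos_left (hg x) h
      linarith
    · rw [← h] at h2
      simp at h2
  · exact Continuous.subtype_mk (by fun_prop) _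

end Linking

end

/-- small linking spheres. Let `ψ : U → ℝ^ℓ` be smooth on an open set
`U ⊆ ℝ^N` (`1 ≤ ℓ ≤ N`), and let `z ∈ U` be a zero of `ψ` at which the Fréchet derivative
`Dψ(z)` is surjective.  Then for every `ε > 0` there is a continuous map
`c : S^{ℓ-1} → U ∩ B(z,ε)` avoiding `ψ⁻¹(0)` such that the composite `ψ ∘ c`, viewed as a
continuous map `S^{ℓ-1} → ℝ^ℓ \ {0}`, is not null-homotopic. -/
theorem small_linking_sphere
    (N ℓ : ℕ) (hℓ : 1 ≤ ℓ) (hℓN : ℓ ≤ N)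
    (U : Set (EuclideanSpace ℝ (Fin N))) (hU : IsOpen U)
    (ψ : EuclideanSpace ℝ (Fin N) → EuclideanSpace ℝ (Fin ℓ))
    (hψ : ContDiffOn ℝ (⊤ : ℕ∞) ψ U)
    (z : EuclideanSpace ℝ (Fin N)) (hz : z ∈ U) (hψz : ψ z = 0)
    (hsurj : Function.Surjective ⇑(fderiv ℝ ψ z))
    (ε : ℝ) (hε : 0 < ε) :
    ∃ (c : C(Metric.sphere (0 : EuclideanSpace ℝ (Fin ℓ)) 1, EuclideanSpace ℝ (Fin N)))
      (g : C(Metric.sphere (0 : EuclideanSpace ℝ (Fin ℓ)) 1,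
            {y : EuclideanSpace ℝ (Fin ℓ) // y ≠ 0})),
      (∀ x, c x ∈ U ∩ Metric.ball z ε) ∧
      (∀ x, ψ (c x) ≠ 0) ∧
      (∀ x, (g x : EuclideanSpace ℝ (Fin ℓ)) = ψ (c x)) ∧
      ¬ g.Nullhomotopic := by
  have hdiff : DifferentiableAt ℝ ψ z :=
    (hψ.differentiableOn (by simp)).differentiableAt (hU.mem_nhds hz)
  obtain ⟨A, hA⟩ := (fderiv ℝ ψ z).exists_rightInverse_of_surjective
    (LinearMap.range_eq_top.2 hsurj)
  have hAx : ∀ x, fderiv ℝ ψ z (A x) = x := fun x => congrArg (fun L => L x) hA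
  obtain ⟨ρ, hρ, hball⟩ : ∃ ρ > 0, ∀ y, dist y z < ρ → y ∈ U ∩ Metric.ball z ε ∧
      ‖ψ y - ψ z - fderiv ℝ ψ z (y - z)‖ ≤ (2 * (‖A‖ + 1))⁻¹ * ‖y - z‖ := by
    have h1 := hdiff.hasFDerivAt.isLittleO.def (c := (2 * (‖A‖ + 1))⁻¹) (by positivity)
    exact Metric.eventually_nhds_iff.1
      (((hU.inter Metric.isOpen_ball).eventually_mem ⟨hz, Metric.mem_ball_self hε⟩).and h1)
  have hA0 : 0 < ‖A‖ + 1 := by positivity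
  set δ := ρ / (‖A‖ + 1)
  have hδ : 0 < δ := by positivity
  have hnorm : ∀ x : Metric.sphere (0 : EuclideanSpace ℝ (Fin ℓ)) 1,
      ‖δ • A x‖ ≤ δ * ‖A‖ := by
    intro x
    rw [norm_smul, Real.norm_of_nonneg hδ.le]
    gcongr
    simpa [mem_sphere_zero_iff_norm.1 x.2] using A.le_opNorm x
  have hmem := fun x : Metric.sphere (0 : EuclideanSpace ℝ (Fin ℓ)) 1 =>
    hball (z + δ • A x) (by
      rw [dist_eq_norm, add_sub_cancel_left]
      refine (hnorm x).trans_lt ?_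
      calc δ * ‖A‖ < δ * (‖A‖ + 1) := by gcongr; linarith
        _ = ρ := div_mul_cancel₀ _ hA0.ne')
  have happrox : ∀ x : Metric.sphere (0 : EuclideanSpace ℝ (Fin ℓ)) 1,
      ‖ψ (z + δ • A x) - δ • (x : EuclideanSpace ℝ (Fin ℓ))‖ < δ := by
    intro x
    have h := (hmem x).2
    rw [add_sub_cancel_left, hψz, sub_zero, map_smul, hAx] at h
    calc _ ≤ (2 * (‖A‖ + 1))⁻¹ * ‖δ • A x‖ := h
      _ ≤ (2 * (‖A‖ + 1))⁻¹ * (δ * (‖A‖ + 1)) := by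
        gcongr
        exact (hnorm x).trans (by gcongr; linarith)
      _ = δ / 2 := by field_simp
      _ < δ := half_lt_self hδ
  have hne : ∀ x : Metric.sphere (0 : EuclideanSpace ℝ (Fin ℓ)) 1, ψ (z + δ • A x) ≠ 0 := by
    intro x h
    have := happrox x
    rw [h, zero_sub, norm_neg, norm_smul, mem_sphere_zero_iff_norm.1 x.2,
      Real.norm_of_nonneg hδ.le, mul_one] at this
    exact lt_irrefl _ this
  let c : C(Metric.sphere (0 : EuclideanSpace ℝ (Fin ℓ)) 1, EuclideanSpace ℝ (Fin N)) :=
    ⟨fun x => z + δ • A x, by fun_prop⟩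
  have hcont : Continuous fun x => ψ (c x) :=
    hψ.continuousOn.comp_continuous c.continuous fun x => (hmem x).1.1
  exact ⟨c, ⟨fun x => ⟨ψ (c x), hne x⟩, hcont.subtype_mk _⟩, fun x => (hmem x).1, hne,
    fun _ => rfl, not_nullhomotopic_of_norm_sub_smul_lt _ hδ happrox⟩
end

section
/- Let n ≥ 1 and let ψ : [0,∞) × ℝ^n → ℝ^n be continuous. Suppose ψ₀ := ψ(0, ·) : ℝ^n → ℝ^n is smooth, its only zero is the origin, its derivative Dψ₀(0) is invertible with det Dψ₀(0) > 0, and ψ_t := ψ(t, ·) is smooth for every t > 0. Then for every r > 0 there exists t₀ > 0 such that for all t ∈ (0, t₀]: (a) ψ_t has no zeros on the sphere {|x| = r}; and (b) if in addition every zero x of ψ_t in the open ball B_r has invertible derivative Dψ_t(x), then ψ_t⁻¹(0) ∩ B_r is finite and the signs of its points sum to one: ∑_{x ∈ ψ_t⁻¹(0) ∩ B_r} sign(det Dψ_t(x)) = 1. -/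
/-- The determinant with respect to a basis, as a continuous alternating form. -/
noncomputable def Module.Basis.continuousDet {ι E : Type*} [Fintype ι] [DecidableEq ι]
    [NormedAddCommGroup E] [NormedSpace ℝ E] (b : Module.Basis ι ℝ E) : E [⋀^ι]→L[ℝ] ℝ :=
  { b.det with
    cont := by
      have : FiniteDimensional ℝ E := b.finiteDimensional_of_finite
      change Continuous fun v : ι → E => (b.toMatrix v).det
      refine Continuous.matrix_det (continuous_matrix fun i j => ?_)
      exact (b.coord i).continuous_of_finiteDimensional.comp (continuous_apply j) }

section Divergence

variable {ι E : Type*} [Fintype ι] [DecidableEq ι] [NormedAddCommGroup E] [NormedSpace ℝ E]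

open Function Finset

theorem Module.Basis.continuousDet_apply (b : Module.Basis ι ℝ E) (v : ι → E) :
    b.continuousDet v = b.det v := rfl

theorem Module.Basis.continuousDet_map (b : Module.Basis ι ℝ E) (L : E →L[ℝ] E) :
    b.continuousDet (fun i => L (b i)) = L.det := by
  have := b.det_comp (L : E →ₗ[ℝ] E) b
  rw [b.det_self, mul_one] at this
  exact this

/-- Cramer's rule in a basis-free form. -/
theorem Module.Basis.sum_continuousDet_update_smul (b : Module.Basis ι ℝ E) (v : ι → E) (u : E) :
    ∑ i, b.continuousDet (update v i u) • v i = b.continuousDet v • u := by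
  apply b.repr.injective
  ext k
  have h := congrFun (Matrix.mulVec_cramer (b.toMatrix v) (b.repr u)) k
  simp only [Matrix.mulVec, dotProduct, Matrix.cramer_apply, Pi.smul_apply, smul_eq_mul] at h
  simp only [map_sum, map_smul, Finsupp.coe_finsetSum, Finset.sum_apply, Finsupp.smul_apply,
    smul_eq_mul, continuousDet_apply, Module.Basis.det_apply, b.toMatrix_update]
  rw [← h]
  exact Finset.sum_congr rfl fun i _ => mul_comm _ _

/-- Inserting a symmetric family of vectors in two slots of an alternating form cancels out. -/
theorem ContinuousAlternatingMap.sum_update_update_eq_zero (ω : E [⋀^ι]→L[ℝ] ℝ) (v : ι → E)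
    (u : E) (w : ι → ι → E) (hw : ∀ i j, w i j = w j i) :
    ∑ i, ∑ j ∈ univ.erase i, ω (update (update v i u) j (w i j)) = 0 := by
  set T : ι → ι → ℝ := fun i j => if j = i then 0 else ω (update (update v i u) j (w i j))
    with hT
  have hsum : ∑ i, ∑ j ∈ univ.erase i, ω (update (update v i u) j (w i j)) =
      ∑ i, ∑ j, T i j := by
    refine sum_congr rfl fun i _ => ?_
    rw [← sum_erase univ (a := i) (by simp [hT])]
    exact sum_congr rfl fun j hj => by simp [hT, ne_of_mem_erase hj]
  have hanti : ∀ i j, T i j = -T j i := by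
    intro i j
    by_cases hij : j = i
    · simp [hT, hij]
    · have hswap : update (update v i u) j (w i j) ∘ Equiv.swap i j =
          update (update v j u) i (w j i) := by
        ext1 k
        rcases eq_or_ne k i with rfl | hki
        · simp [hw]
        rcases eq_or_ne k j with rfl | hkj
        · simp [hij, Ne.symm hij]
        · simp [Equiv.swap_apply_of_ne_of_ne hki hkj, hki, hkj]
      have := ω.toAlternatingMap.map_swap (update (update v i u) j (w i j)) (Ne.symm hij)
      rw [hswap] at this
      simp only [ContinuousAlternatingMap.coe_toAlternatingMap] at this
      simp [hT, hij, Ne.symm hij, this]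
  have hneg : ∑ i, ∑ j, T i j = -∑ i, ∑ j, T i j := by
    conv_lhs => rw [sum_comm]
    simp_rw [← sum_neg_distrib]
    exact sum_congr rfl fun i _ => sum_congr rfl fun j _ => hanti j i
  rw [hsum]
  linarith

/-- The Piola identity: the variation of the pulled back density `ρ(h) det Dh` in the direction
`g` is a divergence. -/
theorem Module.Basis.sum_fderiv_mul_continuousDet_update (b : Module.Basis ι ℝ E)
    {h g : E → E} {ρ : E → ℝ} (hh : ContDiff ℝ 2 h) (hg : Differentiable ℝ g)
    (hρ : Differentiable ℝ ρ) (x : E) :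
    ∑ i, fderiv ℝ (fun y => ρ (h y) *
        b.continuousDet (update (fun j => fderiv ℝ h y (b j)) i (g y))) x (b i) =
      fderiv ℝ ρ (h x) (g x) * b.continuousDet (fun j => fderiv ℝ h x (b j)) +
      ρ (h x) * ∑ i, b.continuousDet
        (update (fun j => fderiv ℝ h x (b j)) i (fderiv ℝ g x (b i))) := by
  have hh1 : Differentiable ℝ h := hh.differentiable (by norm_num)
  have hh2 : Differentiable ℝ (fderiv ℝ h) :=
    (hh.fderiv_right (m := 1) (by norm_num)).differentiable (by norm_num)
  have hdet : ∀ i, DifferentiableAt ℝ (fun y => b.continuousDet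
      (update (fun j => fderiv ℝ h y (b j)) i (g y))) x ∧
      fderiv ℝ (fun y => b.continuousDet
        (update (fun j => fderiv ℝ h y (b j)) i (g y))) x (b i) =
      b.continuousDet (update (fun j => fderiv ℝ h x (b j)) i (fderiv ℝ g x (b i))) +
      ∑ j ∈ univ.erase i, b.continuousDet (update (update (fun j => fderiv ℝ h x (b j)) i (g x)) j
        (fderiv ℝ (fderiv ℝ h) x (b i) (b j))) := by
    intro i
    set G : ι → E → E := fun j y => update (fun j => fderiv ℝ h y (b j)) i (g y) j with hG
    have hGi : G i = g := by ext y; simp [hG]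
    have hGj : ∀ j, j ≠ i → G j = fun y => fderiv ℝ h y (b j) := by
      intro j hj; ext y; simp [hG, hj]
    have hGd : ∀ j, DifferentiableAt ℝ (G j) x := by
      intro j
      rcases eq_or_ne j i with rfl | hj
      · rw [hGi]; exact hg x
      · rw [hGj j hj]; fun_prop
    refine ⟨(differentiableAt_const b.continuousDet).continuousAlternatingMap_apply hGd, ?_⟩
    have := fderiv_continuousAlternatingMap_apply_apply
      (differentiableAt_const (𝕜 := ℝ) b.continuousDet) hGd (b i)
    refine this.trans ?_
    rw [fderiv_const_apply, zero_apply, ContinuousAlternatingMap.coe_zero, Pi.zero_apply, zero_add]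
    rw [← add_sum_erase univ _ (mem_univ i), hGi]
    congr 1
    · simp [hG]
    · refine sum_congr rfl fun j hj => ?_
      rw [hGj j (ne_of_mem_erase hj), fderiv_clm_apply (hh2 x) (differentiableAt_const _)]
      simp [hG]
  have hsymm : ∀ i j, fderiv ℝ (fderiv ℝ h) x (b i) (b j) = fderiv ℝ (fderiv ℝ h) x (b j) (b i) :=
    fun i j => (hh.contDiffAt.isSymmSndFDerivAt (by simp)) _ _
  have hterm : ∀ i, fderiv ℝ (fun y => ρ (h y) *
        b.continuousDet (update (fun j => fderiv ℝ h y (b j)) i (g y))) x (b i) =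
      fderiv ℝ ρ (h x) (b.continuousDet (update (fun j => fderiv ℝ h x (b j)) i (g x)) •
        fderiv ℝ h x (b i)) +
      ρ (h x) * b.continuousDet
        (update (fun j => fderiv ℝ h x (b j)) i (fderiv ℝ g x (b i))) +
      ρ (h x) * ∑ j ∈ univ.erase i, b.continuousDet
        (update (update (fun j => fderiv ℝ h x (b j)) i (g x)) j
        (fderiv ℝ (fderiv ℝ h) x (b i) (b j))) := by
    intro i
    have hρh : HasFDerivAt (fun y => ρ (h y)) ((fderiv ℝ ρ (h x)).comp (fderiv ℝ h x)) x :=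
      (hρ (h x)).hasFDerivAt.comp x (hh1 x).hasFDerivAt
    rw [fderiv_fun_mul hρh.differentiableAt (hdet i).1, hρh.fderiv]
    simp only [add_apply, _root_.smul_apply, (hdet i).2,
      ContinuousLinearMap.comp_apply, smul_eq_mul, map_smul]
    ring
  simp_rw [hterm, sum_add_distrib, ← mul_sum]
  rw [ContinuousAlternatingMap.sum_update_update_eq_zero b.continuousDet _ _ _ hsymm, ← map_sum,
    b.sum_continuousDet_update_smul, map_smul, smul_eq_mul]
  ring

end Divergence

section HomotopyInvariance

open Function MeasureTheory Set

variable {E : Type*} [NormedAddCommGroup E] [NormedSpace ℝ E] [FiniteDimensional ℝ E]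
  [MeasurableSpace E] [BorelSpace E] (μ : Measure E) [μ.IsAddHaarMeasure]

theorem integral_fderiv_eq_zero_of_hasCompactSupport {V : E → ℝ} (hV : ContDiff ℝ 1 V)
    (hc : HasCompactSupport V) (v : E) : ∫ x, fderiv ℝ V x v ∂μ = 0 := by
  have hd : Continuous fun x => fderiv ℝ V x v :=
    (hV.continuous_fderiv (by norm_num)).clm_apply continuous_const
  have hdc : HasCompactSupport fun x => fderiv ℝ V x v := hc.fderiv_apply ℝ v
  have := integral_mul_fderiv_eq_neg_fderiv_mul_of_integrable (μ := μ) (f := fun _ : E => (1 : ℝ))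
    (g := V) (v := v) (by simp) (by simpa using hd.integrable_of_hasCompactSupport hdc)
    (by simpa using hV.continuous.integrable_of_hasCompactSupport hc) (by fun_prop)
    (fun x _ => hV.differentiable (by norm_num) x)
  simpa using this

omit [FiniteDimensional ℝ E] in
theorem hasDerivAt_integral_of_contDiff_of_compact {G : ℝ × E → ℝ} (hG : ContDiff ℝ 1 G)
    {K : Set E} (hK : IsCompact K) (hGK : ∀ s, ∀ x ∉ K, G (s, x) = 0) (s : ℝ) :
    HasDerivAt (fun s => ∫ x, G (s, x) ∂μ) (∫ x, fderiv ℝ G (s, x) (1, 0) ∂μ) s := by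
  have hcont : Continuous fun p : ℝ × E => fderiv ℝ G p (1, 0) :=
    (hG.continuous_fderiv (by norm_num)).clm_apply continuous_const
  have hcs : ∀ t, Continuous fun x => G (t, x) := fun t => hG.continuous.comp (by fun_prop)
  have hderiv : ∀ t x, HasDerivAt (fun t => G (t, x)) (fderiv ℝ G (t, x) (1, 0)) t := by
    intro t x
    have h1 : HasDerivAt (fun t : ℝ => (t, x)) ((1 : ℝ), (0 : E)) t :=
      (hasDerivAt_id t).prodMk (hasDerivAt_const t x)
    exact ((hG.differentiable (by norm_num) (t, x)).hasFDerivAt).comp_hasDerivAt t h1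
  have hzero : ∀ t, ∀ x ∉ K, fderiv ℝ G (t, x) (1, 0) = 0 := by
    intro t x hx
    refine (hderiv t x).unique ?_
    simp only [hGK _ x hx]
    exact hasDerivAt_const _ _
  obtain ⟨C, hC⟩ := ((isCompact_closedBall s 1).prod hK).exists_bound_of_continuousOn
    hcont.continuousOn
  refine (hasDerivAt_integral_of_dominated_loc_of_deriv_le
    (bound := K.indicator fun _ => C) (F' := fun t x => fderiv ℝ G (t, x) (1, 0))
    (Metric.closedBall_mem_nhds s one_pos)
    (.of_forall fun t => (hcs t).aestronglyMeasurable)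
    ((hcs s).integrable_of_hasCompactSupport (.intro hK (hGK s)))
    (hcont.comp (by fun_prop : Continuous fun x : E => (s, x))).aestronglyMeasurable
    (.of_forall fun x t ht => ?_) ?_ (.of_forall fun x t _ => hderiv t x)).2
  · by_cases hx : x ∈ K
    · rw [indicator_of_mem hx]; exact hC (t, x) ⟨ht, hx⟩
    · rw [indicator_of_notMem hx, hzero t x hx, norm_zero]
  · exact (integrable_indicator_iff hK.measurableSet).2
      (integrableOn_const hK.measure_lt_top.ne)

/-- Homotopy invariance of the degree integral along the segment from `f` to `f + g`, for a cutoff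
`χ` whose derivative vanishes wherever `ρ` does not along the homotopy. -/
theorem integral_cutoff_mul_det_fderiv_eq {f g : E → E} {ρ χ : E → ℝ} (hf : ContDiff ℝ 2 f)
    (hg : ContDiff ℝ 2 g) (hρ : ContDiff ℝ 1 ρ) (hχ : ContDiff ℝ 1 χ) (hc : HasCompactSupport χ)
    (hs : ∀ s ∈ Icc (0 : ℝ) 1, ∀ x, fderiv ℝ χ x ≠ 0 → ρ (f x + s • g x) = 0) :
    ∫ x, χ x * (ρ (f x) * (fderiv ℝ f x).det) ∂μ =
      ∫ x, χ x * (ρ (f x + g x) * (fderiv ℝ f x + fderiv ℝ g x).det) ∂μ := by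
  classical
  let b := Module.finBasis ℝ E
  have hω : ContDiff ℝ 1 b.continuousDet :=
    b.continuousDet.toContinuousMultilinearMap.contDiff
  have hf' : ContDiff ℝ 1 (fderiv ℝ f) := hf.fderiv_right (by norm_num)
  have hg' : ContDiff ℝ 1 (fderiv ℝ g) := hg.fderiv_right (by norm_num)
  have hf1 : ContDiff ℝ 1 f := hf.of_le (by norm_num)
  have hg1 : ContDiff ℝ 1 g := hg.of_le (by norm_num)
  set D : ℝ → E → Fin (Module.finrank ℝ E) → E :=
    fun s x j => fderiv ℝ f x (b j) + s • fderiv ℝ g x (b j) with hD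
  set G : ℝ × E → ℝ := fun p =>
    χ p.2 * (ρ (f p.2 + p.1 • g p.2) * b.continuousDet (D p.1 p.2)) with hGdef
  have hG : ContDiff ℝ 1 G := by
    refine (hχ.comp contDiff_snd).mul ((hρ.comp ?_).mul (hω.comp (contDiff_pi.2 fun j => ?_)))
    · exact (hf1.comp contDiff_snd).add (contDiff_fst.smul (hg1.comp contDiff_snd))
    · exact ((hf'.comp contDiff_snd).clm_apply contDiff_const).add
        (contDiff_fst.smul ((hg'.comp contDiff_snd).clm_apply contDiff_const))
  have hGK : ∀ s, ∀ x ∉ tsupport χ, G (s, x) = 0 := by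
    intro s x hx
    simp [hGdef, image_eq_zero_of_notMem_tsupport hx]
  have hder := hasDerivAt_integral_of_contDiff_of_compact μ hG hc hGK
  have hdet : ∀ s x, b.continuousDet (D s x) = (fderiv ℝ f x + s • fderiv ℝ g x).det := by
    intro s x
    rw [← b.continuousDet_map]
    rfl
  have hzero : ∀ s ∈ Icc (0 : ℝ) 1, ∫ x, fderiv ℝ G (s, x) (1, 0) ∂μ = 0 := by
    intro s hs01
    set h : E → E := fun x => f x + s • g x with hh
    have hhc : ContDiff ℝ 2 h := hf.add (hg.const_smul s)
    have hhd : ∀ x, fderiv ℝ h x = fderiv ℝ f x + s • fderiv ℝ g x := by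
      intro x
      exact ((hf1.differentiable (by norm_num) x).hasFDerivAt.add
        ((hg1.differentiable (by norm_num) x).hasFDerivAt.const_smul s)).fderiv
    have hDh : ∀ x, D s x = fun j => fderiv ℝ h x (b j) := by
      intro x; ext j; simp [hD, hhd]
    set V : Fin (Module.finrank ℝ E) → E → ℝ := fun i y => ρ (h y) *
      b.continuousDet (update (fun j => fderiv ℝ h y (b j)) i (g y)) with hV
    have hVc : ∀ i, ContDiff ℝ 1 (V i) := by
      intro i
      refine (hρ.comp (hhc.of_le (by norm_num))).mul (hω.comp (contDiff_pi.2 fun j => ?_))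
      rcases eq_or_ne j i with rfl | hj
      · simpa using hg1
      · simpa [hj] using (hhc.fderiv_right (m := 1) (by norm_num)).clm_apply contDiff_const
    have hχV : ∀ i x, fderiv ℝ (fun y => χ y * V i y) x (b i) =
        χ x * fderiv ℝ (V i) x (b i) := by
      intro i x
      rw [fderiv_fun_mul (hχ.differentiable (by norm_num) x)
        ((hVc i).differentiable (by norm_num) x)]
      by_cases hx : fderiv ℝ χ x = 0
      · simp [hx]
      · simp [hV, hh, hs s hs01 x hx]
    have hpoint : ∀ x, fderiv ℝ G (s, x) (1, 0) =
        ∑ i, fderiv ℝ (fun y => χ y * V i y) x (b i) := by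
      intro x
      simp_rw [hχV, ← Finset.mul_sum]
      rw [b.sum_fderiv_mul_continuousDet_update hhc (hg1.differentiable (by norm_num))
        (hρ.differentiable (by norm_num))]
      have h1 : HasDerivAt (fun t : ℝ => (t, x)) ((1 : ℝ), (0 : E)) s :=
        (hasDerivAt_id s).prodMk (hasDerivAt_const s x)
      refine (((hG.differentiable (by norm_num) (s, x)).hasFDerivAt).comp_hasDerivAt s h1).unique ?_
      have h2 : HasDerivAt (fun t : ℝ => f x + t • g x) (g x) s := by
        simpa using ((hasDerivAt_id s).smul_const (g x)).const_add (f x)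
      have h3 : HasDerivAt (fun t => ρ (f x + t • g x)) (fderiv ℝ ρ (h x) (g x)) s :=
        ((hρ.differentiable (by norm_num) (h x)).hasFDerivAt).comp_hasDerivAt s h2
      have h4 : HasDerivAt (fun t => D t x) (fun j => fderiv ℝ g x (b j)) s := by
        refine hasDerivAt_pi.2 fun j => ?_
        simpa [hD] using ((hasDerivAt_id s).smul_const (fderiv ℝ g x (b j))).const_add
          (fderiv ℝ f x (b j))
      have h5 := (b.continuousDet.hasFDerivAt (D s x)).comp_hasDerivAt s h4
      refine ((h3.mul h5).const_mul (χ x)).congr_deriv ?_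
      simp only [ContinuousMultilinearMap.linearDeriv_apply, hDh, hh, Function.comp]
      rfl
    simp_rw [hpoint]
    have hcV : ∀ i, HasCompactSupport fun y => χ y * V i y := fun i => hc.mul_right
    rw [integral_finsetSum]
    · exact Finset.sum_eq_zero fun i _ =>
        integral_fderiv_eq_zero_of_hasCompactSupport μ (hχ.mul (hVc i)) (hcV i) _
    · intro i _
      exact (((hχ.mul (hVc i)).continuous_fderiv (by norm_num)).clm_apply
        continuous_const).integrable_of_hasCompactSupport ((hcV i).fderiv_apply ℝ _)
  have hconst := constant_of_has_deriv_right_zero (f := fun s => ∫ x, G (s, x) ∂μ) (a := 0) (b := 1)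
    (fun s _ => (hder s).continuousAt.continuousWithinAt)
    (fun s hs' => by
      have := (hder s).hasDerivWithinAt (s := Ici s)
      rwa [hzero s ⟨hs'.1, hs'.2.le⟩] at this) 1 (right_mem_Icc.2 zero_le_one)
  simp only [hGdef, hdet, zero_smul, add_zero, one_smul] at hconst
  exact hconst.symm

end HomotopyInvariance

section Counting

open MeasureTheory Set Filter Topology Metric

variable {E : Type*} [NormedAddCommGroup E] [NormedSpace ℝ E] [FiniteDimensional ℝ E]

theorem ContDiff.exists_isOpen_injOn_of_det_ne_zero {f : E → E} (hf : ContDiff ℝ 1 f) {a : E}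
    (ha : (fderiv ℝ f a).det ≠ 0) {W : Set E} (hW : W ∈ 𝓝 a) :
    ∃ U ⊆ W, IsOpen U ∧ a ∈ U ∧ InjOn f U ∧ f '' U ∈ 𝓝 (f a) ∧
      ∀ x ∈ U, (fderiv ℝ f x).det =
        Real.sign (fderiv ℝ f a).det * |(fderiv ℝ f x).det| := by
  have : CompleteSpace E := FiniteDimensional.complete ℝ E
  have hstrict : HasStrictFDerivAt f
      ((fderiv ℝ f a).toContinuousLinearEquivOfDetNeZero ha : E →L[ℝ] E) a := by
    rw [ContinuousLinearMap.coe_toContinuousLinearEquivOfDetNeZero]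
    exact hf.contDiffAt.hasStrictFDerivAt (by norm_num)
  have hdet : Continuous fun x => (fderiv ℝ f x).det :=
    ContinuousLinearMap.continuous_det.comp (hf.continuous_fderiv (by norm_num))
  have hsign : ∀ᶠ x in 𝓝 a, (fderiv ℝ f x).det =
      Real.sign (fderiv ℝ f a).det * |(fderiv ℝ f x).det| := by
    rcases lt_or_gt_of_ne ha with h | h
    · filter_upwards [hdet.continuousAt.eventually_lt_const h] with x hx
      rw [Real.sign_of_neg h, abs_of_neg hx]; ring
    · filter_upwards [hdet.continuousAt.eventually_const_lt h] with x hx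
      rw [Real.sign_of_pos h, abs_of_pos hx, one_mul]
  let e := hstrict.toOpenPartialHomeomorph f
  obtain ⟨U, hU, hUo, haU⟩ := _root_.mem_nhds_iff.1 (inter_mem (inter_mem hW hsign)
    (e.open_source.mem_nhds hstrict.mem_toOpenPartialHomeomorph_source))
  refine ⟨U, fun x hx => (hU hx).1.1, hUo, haU, ?_, ?_, fun x hx => (hU hx).1.2⟩
  · exact e.injOn.mono fun x hx => (hU hx).2
  · rw [← hstrict.map_nhds_eq_of_equiv]
    exact image_mem_map (hUo.mem_nhds haU)

theorem finite_zeros_of_det_fderiv_ne_zero {f : E → E} (hf : ContDiff ℝ 1 f) {K : Set E}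
    (hK : IsCompact K) (hreg : ∀ x ∈ K, f x = 0 → (fderiv ℝ f x).det ≠ 0) :
    {x ∈ K | f x = 0}.Finite := by
  have hZ : IsCompact {x ∈ K | f x = 0} :=
    hK.inter_right (isClosed_singleton.preimage hf.continuous)
  have hU : ∀ a, ∃ U ∈ 𝓝 a, a ∈ {x ∈ K | f x = 0} → InjOn f U := by
    intro a
    by_cases ha : a ∈ {x ∈ K | f x = 0}
    · obtain ⟨U, -, hUo, haU, hinj, -⟩ :=
        hf.exists_isOpen_injOn_of_det_ne_zero (hreg a ha.1 ha.2) univ_mem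
      exact ⟨U, hUo.mem_nhds haU, fun _ => hinj⟩
    · exact ⟨univ, univ_mem, fun h => absurd h ha⟩
  choose U hUn hUi using hU
  obtain ⟨t, ht, hcov⟩ := hZ.elim_nhds_subcover U fun x _ => hUn x
  refine t.finite_toSet.subset fun x hx => ?_
  obtain ⟨a, hat, hxa⟩ := mem_iUnion₂.1 (hcov hx)
  rwa [hUi a (ht a hat) hxa (mem_of_mem_nhds (hUn a)) (hx.2.trans (ht a hat).2.symm)]

variable [MeasurableSpace E] [BorelSpace E] (μ : Measure E) [μ.IsAddHaarMeasure]

/-- The degree integral against a density concentrated near `0` counts zeros with sign. -/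
theorem exists_integral_cutoff_mul_det_fderiv_eq_sum_sign {f : E → E} (hf : ContDiff ℝ 1 f)
    {K O : Set E} (hK : IsCompact K) (hO : IsOpen O) {χ : E → ℝ} (hχ : Continuous χ)
    (hχK : ∀ x ∉ K, χ x = 0) (hχO : ∀ x ∈ O, χ x = 1) {S : Finset E}
    (hS : (S : Set E) = {x ∈ K | f x = 0}) (hSO : (S : Set E) ⊆ O)
    (hreg : ∀ x ∈ S, (fderiv ℝ f x).det ≠ 0) :
    ∃ ε > 0, ∀ ρ : E → ℝ, Continuous ρ → (∀ y, ε ≤ ‖y‖ → ρ y = 0) → ∫ y, ρ y ∂μ = 1 →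
      ∫ x, χ x * (ρ (f x) * (fderiv ℝ f x).det) ∂μ =
        ∑ x ∈ S, Real.sign (fderiv ℝ f x).det := by
  obtain ⟨V, hV, hVd⟩ := S.finite_toSet.t2_separation
  have hU : ∀ a, ∃ U : Set E, a ∈ S → U ⊆ V a ∩ O ∧ IsOpen U ∧ a ∈ U ∧ InjOn f U ∧
      f '' U ∈ 𝓝 0 ∧ ∀ x ∈ U, (fderiv ℝ f x).det =
        Real.sign (fderiv ℝ f a).det * |(fderiv ℝ f x).det| := by
    intro a
    by_cases ha : a ∈ S
    · obtain ⟨U, h1, h2, h3, h4, h5, h6⟩ := hf.exists_isOpen_injOn_of_det_ne_zero (hreg a ha)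
        (inter_mem ((hV a).2.mem_nhds (hV a).1) (hO.mem_nhds (hSO ha)))
      have hfa : f a = 0 := by
        have : a ∈ (S : Set E) := ha
        rw [hS] at this
        exact this.2
      rw [hfa] at h5
      exact ⟨U, fun _ => ⟨h1, h2, h3, h4, h5, h6⟩⟩
    · exact ⟨∅, fun h => absurd h ha⟩
  choose U hU using hU
  have hL : IsCompact (K \ ⋃ a ∈ S, U a) :=
    hK.diff (isOpen_biUnion fun a ha => (hU a ha).2.1)
  have hL0 : (f '' (K \ ⋃ a ∈ S, U a))ᶜ ∈ 𝓝 (0 : E) := by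
    refine (hL.image hf.continuous).isClosed.isOpen_compl.mem_nhds ?_
    rintro ⟨x, ⟨hxK, hxU⟩, hx⟩
    have hxS : x ∈ (S : Set E) := by rw [hS]; exact ⟨hxK, hx⟩
    exact hxU (mem_iUnion₂.2 ⟨x, hxS, (hU x hxS).2.2.1⟩)
  have hI : (⋂ a ∈ S, f '' U a) ∈ 𝓝 (0 : E) :=
    (biInter_finset_mem S).2 fun a ha => (hU a ha).2.2.2.2.1
  obtain ⟨ε, hε, hball⟩ := Metric.mem_nhds_iff.1 (inter_mem hL0 hI)
  refine ⟨ε, hε, fun ρ hρ hρε hρ1 => ?_⟩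
  have hρmem : ∀ y, ρ y ≠ 0 → y ∈ ball (0 : E) ε := by
    intro y hy
    rw [mem_ball_zero_iff]
    exact lt_of_not_ge fun h => hy (hρε y h)
  have hdet : Continuous fun x => (fderiv ℝ f x).det :=
    ContinuousLinearMap.continuous_det.comp (hf.continuous_fderiv (by norm_num))
  have hint : Integrable (fun x => χ x * (ρ (f x) * (fderiv ℝ f x).det)) μ := by
    refine (hχ.mul ((hρ.comp hf.continuous).mul hdet)).integrable_of_hasCompactSupport
      (.intro hK fun x hx => ?_)
    simp [hχK x hx]
  rw [← setIntegral_eq_integral_of_forall_compl_eq_zero (s := ⋃ a ∈ S, U a),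
    integral_biUnion_finset S (fun a ha => (hU a ha).2.1.measurableSet)
      (fun a ha b hb hab => (hVd ha hb hab).mono (fun x hx => ((hU a ha).1 hx).1)
        (fun x hx => ((hU b hb).1 hx).1)) (fun a _ => hint.integrableOn)]
  · refine Finset.sum_congr rfl fun a ha => ?_
    obtain ⟨hUV, hUo, -, hinj, -, hsign⟩ := hU a ha
    have hcv := integral_image_eq_integral_abs_det_fderiv_smul μ hUo.measurableSet
      (fun x _ => (hf.differentiable (by norm_num) x).hasFDerivAt.hasFDerivWithinAt) hinj ρ
    rw [setIntegral_eq_integral_of_forall_compl_eq_zero, hρ1] at hcv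
    · calc ∫ x in U a, χ x * (ρ (f x) * (fderiv ℝ f x).det) ∂μ
          = ∫ x in U a, Real.sign (fderiv ℝ f a).det *
              (|(fderiv ℝ f x).det| • ρ (f x)) ∂μ := by
            refine setIntegral_congr_fun hUo.measurableSet fun x hx => ?_
            simp only [hχO x (hUV hx).2, smul_eq_mul]
            linear_combination ρ (f x) * hsign x hx
        _ = Real.sign (fderiv ℝ f a).det := by rw [integral_const_mul, ← hcv, mul_one]
    · intro y hy
      by_contra h
      exact hy (mem_iInter₂.1 (hball (hρmem y h)).2 a ha)
  · intro x hx
    by_cases hxK : x ∈ K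
    · have : ρ (f x) = 0 := by
        by_contra h
        exact (hball (hρmem _ h)).1 ⟨x, ⟨hxK, hx⟩, rfl⟩
      simp [this]
    · simp [hχK x hxK]

end Counting

section Degree

open MeasureTheory Set Metric

variable {E : Type*} [NormedAddCommGroup E] [NormedSpace ℝ E] [FiniteDimensional ℝ E]

/-- The signed count of zeros in a ball is invariant under a segment homotopy which does not
vanish on the boundary sphere. -/
theorem sum_sign_det_fderiv_eq_of_segment_ne_zero {f g : E → E} (hf : ContDiff ℝ 2 f)
    (hg : ContDiff ℝ 2 g) {r : ℝ} (hr : 0 < r)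
    (hne : ∀ s ∈ Icc (0 : ℝ) 1, ∀ x, ‖x‖ = r → f x + s • (g x - f x) ≠ 0) {S T : Finset E}
    (hS : (S : Set E) = {x ∈ ball (0 : E) r | f x = 0})
    (hT : (T : Set E) = {x ∈ ball (0 : E) r | g x = 0})
    (hSreg : ∀ x ∈ S, (fderiv ℝ f x).det ≠ 0) (hTreg : ∀ x ∈ T, (fderiv ℝ g x).det ≠ 0) :
    ∑ x ∈ S, Real.sign (fderiv ℝ f x).det = ∑ x ∈ T, Real.sign (fderiv ℝ g x).det := by
  borelize E
  let μ : Measure E := Measure.addHaar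
  set H : ℝ × E → E := fun p => f p.2 + p.1 • (g p.2 - f p.2) with hH
  have hfc := hf.continuous
  have hgc := hg.continuous
  have hHc : Continuous H := by fun_prop
  have hK : IsCompact (closedBall (0 : E) r) := isCompact_closedBall 0 r
  have hI : IsCompact (Icc (0 : ℝ) 1) := isCompact_Icc
  have hZ : IsCompact ((Icc (0 : ℝ) 1 ×ˢ closedBall (0 : E) r) ∩ H ⁻¹' {0}) :=
    (hI.prod hK).inter_right (isClosed_singleton.preimage hHc)
  obtain ⟨c, hc, hcZ⟩ := hZ.exists_forall_le' (f := fun p => r - ‖p.2‖) (a := 0)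
    (by fun_prop) (by
      rintro ⟨s, x⟩ ⟨⟨hs, hx⟩, h0⟩
      rw [mem_closedBall_zero_iff] at hx
      exact sub_pos.2 (lt_of_le_of_ne hx fun h => hne s hs x h h0))
  let r' := max (r - c / 2) (r / 2)
  have hr'0 : 0 < r' := lt_max_of_lt_right (by linarith)
  have hr'r : r' < r := max_lt (by linarith) (by linarith)
  have hzero : ∀ s ∈ Icc (0 : ℝ) 1, ∀ x, ‖x‖ ≤ r → H (s, x) = 0 → ‖x‖ < r' := by
    intro s hs x hx h0
    have h1 : c ≤ r - ‖x‖ := hcZ (s, x) ⟨⟨hs, mem_closedBall_zero_iff.2 hx⟩, h0⟩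
    exact lt_max_of_lt_left (by linarith)
  have hA : IsCompact (closedBall (0 : E) r \ ball 0 r') := hK.diff isOpen_ball
  obtain ⟨δ, hδ, hδA⟩ := (hI.prod hA).exists_forall_le' (f := fun p => ‖H p‖) (a := 0)
    (by fun_prop) (by
      rintro ⟨s, x⟩ ⟨hs, hx, hx'⟩
      refine norm_pos_iff.2 fun h0 => hx' (mem_ball_zero_iff.2 ?_)
      exact hzero s hs x (mem_closedBall_zero_iff.1 hx) h0)
  let χ : ContDiffBump (0 : E) := ⟨r', r, hr'0, hr'r⟩
  have hcount : ∀ (u : E → E) (R : Finset E) (s : ℝ), s ∈ Icc (0 : ℝ) 1 → ContDiff ℝ 2 u →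
      (R : Set E) = {x ∈ ball (0 : E) r | u x = 0} → (∀ x ∈ R, (fderiv ℝ u x).det ≠ 0) →
      (∀ x, u x = H (s, x)) →
      ∃ ε > 0, ∀ ρ : E → ℝ, Continuous ρ → (∀ y, ε ≤ ‖y‖ → ρ y = 0) → ∫ y, ρ y ∂μ = 1 →
        ∫ x, χ x * (ρ (u x) * (fderiv ℝ u x).det) ∂μ =
          ∑ x ∈ R, Real.sign (fderiv ℝ u x).det := by
    intro u R s hs hu hR hreg huH
    refine exists_integral_cutoff_mul_det_fderiv_eq_sum_sign μ (hu.of_le (by norm_num)) hK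
      (isOpen_ball (x := (0 : E)) (ε := r')) χ.continuous (fun x hx => ?_) (fun x hx => ?_) ?_ ?_
      hreg
    · rw [mem_closedBall, not_le] at hx
      exact χ.zero_of_le_dist hx.le
    · exact χ.one_of_mem_closedBall (ball_subset_closedBall hx)
    · rw [hR]
      ext x
      refine ⟨fun hx => ⟨ball_subset_closedBall hx.1, hx.2⟩, fun hx => ⟨?_, hx.2⟩⟩
      have := hzero s hs x (mem_closedBall_zero_iff.1 hx.1) (by rw [← huH]; exact hx.2)
      exact mem_ball_zero_iff.2 (this.trans hr'r)
    · rw [hR]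
      intro x hx
      have := hzero s hs x (mem_ball_zero_iff.1 hx.1).le (by rw [← huH]; exact hx.2)
      exact mem_ball_zero_iff.2 this
  obtain ⟨ε₁, hε₁, h₁⟩ := hcount f S 0 (by simp) hf hS hSreg (by simp [hH])
  obtain ⟨ε₂, hε₂, h₂⟩ := hcount g T 1 (by simp) hg hT hTreg (by simp [hH])
  let ε := min δ (min ε₁ ε₂)
  have hε0 : 0 < ε := lt_min hδ (lt_min hε₁ hε₂)
  let φ : ContDiffBump (0 : E) := ⟨ε / 2, ε, by linarith, by linarith⟩
  have hφ : ∀ y, ε ≤ ‖y‖ → φ.normed μ y = 0 := by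
    intro y hy
    have : y ∉ Function.support (φ.normed μ) := by
      rw [φ.support_normed_eq, mem_ball_zero_iff]
      exact not_lt.2 hy
    simpa using this
  have hφc : Continuous (φ.normed μ) := φ.continuous_normed
  have hsupp : ∀ s ∈ Icc (0 : ℝ) 1, ∀ x, fderiv ℝ χ x ≠ 0 →
      φ.normed μ (f x + s • (g x - f x)) = 0 := by
    intro s hs x hx
    refine hφ _ ((min_le_left _ _).trans (hδA (s, x) ⟨hs, ?_, fun hx' => hx ?_⟩))
    · have := support_fderiv_subset ℝ (f := χ) hx
      rwa [χ.tsupport_eq] at this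
    · rw [(χ.eventuallyEq_one_of_mem_ball hx').fderiv_eq]
      simp
  rw [← h₁ _ hφc (fun y hy => hφ y (((min_le_right _ _).trans (min_le_left _ _)).trans hy))
      φ.integral_normed,
    ← h₂ _ hφc (fun y hy => hφ y (((min_le_right _ _).trans (min_le_right _ _)).trans hy))
      φ.integral_normed]
  have hmain := integral_cutoff_mul_det_fderiv_eq μ hf (hg.sub hf)
    (φ.contDiff_normed (μ := μ) (n := 1)) (χ.contDiff (n := 1)) χ.hasCompactSupport hsupp
  refine hmain.trans (integral_congr_ae (.of_forall fun x => ?_))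
  have hfd := hf.differentiable (by norm_num) x
  have hgd := hg.differentiable (by norm_num) x
  simp only
  rw [fderiv_fun_sub hgd hfd, add_sub_cancel, add_sub_cancel]

end Degree

/-- the cut-count lemma. Let `ψ : [0,∞) × ℝ^n → ℝ^n` be continuous, with
`ψ₀ = ψ(0,·)` smooth, vanishing only at the origin, and with `det Dψ₀(0) > 0` (in particular
`Dψ₀(0)` is invertible), and with `ψ_t = ψ(t,·)` smooth for every `t > 0`.  Then for every
`r > 0` there is `t₀ > 0` such that for all `t ∈ (0, t₀]`: (a) `ψ_t` has no zeros on the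
sphere of radius `r`, and (b) if moreover every zero of `ψ_t` in the open ball `B_r` has
invertible derivative (nonzero determinant), then the zeros of `ψ_t` in `B_r` form a finite
set whose signs `sign (det Dψ_t(x))` sum to one. -/
theorem cut_count
    (n : ℕ) (hn : 1 ≤ n)
    (ψ : ℝ → EuclideanSpace ℝ (Fin n) → EuclideanSpace ℝ (Fin n))
    (hcont : ContinuousOn (fun p : ℝ × EuclideanSpace ℝ (Fin n) => ψ p.1 p.2)
      (Set.Ici (0 : ℝ) ×ˢ (Set.univ : Set (EuclideanSpace ℝ (Fin n)))))
    (hsmooth0 : ContDiff ℝ (⊤ : ℕ∞) (ψ 0))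
    (hzero0 : ∀ x : EuclideanSpace ℝ (Fin n), ψ 0 x = 0 ↔ x = 0)
    (hdet0 : 0 < (fderiv ℝ (ψ 0) 0).det)
    (hsmootht : ∀ t : ℝ, 0 < t → ContDiff ℝ (⊤ : ℕ∞) (ψ t)) :
    ∀ r : ℝ, 0 < r → ∃ t₀ : ℝ, 0 < t₀ ∧ ∀ t ∈ Set.Ioc (0 : ℝ) t₀,
      (∀ x : EuclideanSpace ℝ (Fin n), ‖x‖ = r → ψ t x ≠ 0) ∧
      ((∀ x ∈ Metric.ball (0 : EuclideanSpace ℝ (Fin n)) r,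
          ψ t x = 0 → (fderiv ℝ (ψ t) x).det ≠ 0) →
        ∃ S : Finset (EuclideanSpace ℝ (Fin n)),
          (S : Set (EuclideanSpace ℝ (Fin n))) =
            {x ∈ Metric.ball (0 : EuclideanSpace ℝ (Fin n)) r | ψ t x = 0} ∧
          ∑ x ∈ S, Real.sign ((fderiv ℝ (ψ t) x).det) = 1) := by
  intro r hr
  let E := EuclideanSpace ℝ (Fin n)
  have hΨ : Continuous fun p : ℝ × E => ψ (max p.1 0) p.2 :=
    hcont.comp_continuous (f := fun p : ℝ × E => (max p.1 0, p.2)) (by fun_prop)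
      fun p => Set.mk_mem_prod (Set.mem_Ici.2 (le_max_right _ _)) (Set.mem_univ _)
  have hsphere : IsCompact (Metric.sphere (0 : E) r) := isCompact_sphere 0 r
  have hsegment : ∀ᶠ t in nhds (0 : ℝ), ∀ x ∈ Metric.sphere (0 : E) r,
      ‖ψ (max t 0) x - ψ 0 x‖ < ‖ψ 0 x‖ := by
    refine hsphere.eventually_forall_of_forall_eventually fun x hx => ?_
    have h0 : Continuous fun p : ℝ × E => ψ 0 p.2 := hsmooth0.continuous.comp continuous_snd
    refine (hΨ.sub h0).norm.continuousAt.eventually_lt h0.norm.continuousAt ?_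
    have : ψ 0 x ≠ 0 := fun h => by
      rw [(hzero0 x).1 h] at hx
      simp [hr.ne] at hx
    simpa using this
  obtain ⟨δ, hδ, hball⟩ := Metric.eventually_nhds_iff.1 hsegment
  refine ⟨δ / 2, by linarith, fun t ht => ?_⟩
  have hclose : ∀ x : E, ‖x‖ = r → ‖ψ t x - ψ 0 x‖ < ‖ψ 0 x‖ := by
    intro x hx
    have := hball (y := t) (by
      rw [Real.dist_eq, sub_zero, abs_of_pos ht.1]; linarith [ht.2]) x (by simpa using hx)
    rwa [max_eq_left ht.1.le] at this
  have hne : ∀ s ∈ Set.Icc (0 : ℝ) 1, ∀ x : E, ‖x‖ = r →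
      ψ 0 x + s • (ψ t x - ψ 0 x) ≠ 0 := by
    intro s hs x hx h0
    have h1 : ‖ψ 0 x‖ = s * ‖ψ t x - ψ 0 x‖ := by
      rw [← Real.norm_of_nonneg hs.1, ← norm_smul, ← norm_neg (s • _)]
      exact congrArg norm (eq_neg_of_add_eq_zero_left h0)
    have h2 := hclose x hx
    have h3 := mul_le_of_le_one_left (norm_nonneg (ψ t x - ψ 0 x)) hs.2
    linarith
  have hne_t : ∀ x : E, ‖x‖ = r → ψ t x ≠ 0 := by
    intro x hx h0
    exact hne 1 (by simp) x hx (by simp [h0])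
  refine ⟨hne_t, fun hreg => ?_⟩
  have hballs : {x ∈ Metric.ball (0 : E) r | ψ t x = 0} =
      {x ∈ Metric.closedBall (0 : E) r | ψ t x = 0} := by
    ext x
    refine ⟨fun hx => ⟨Metric.ball_subset_closedBall hx.1, hx.2⟩, fun hx => ⟨?_, hx.2⟩⟩
    exact mem_ball_zero_iff.2 (lt_of_le_of_ne (mem_closedBall_zero_iff.1 hx.1)
      fun h => hne_t x h hx.2)
  have hfin : {x ∈ Metric.ball (0 : E) r | ψ t x = 0}.Finite := by
    rw [hballs]
    refine finite_zeros_of_det_fderiv_ne_zero ((hsmootht t ht.1).of_le (by simp))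
      (isCompact_closedBall 0 r) fun x hx h0 => hreg x ?_ h0
    have hx' : x ∈ {x ∈ Metric.closedBall (0 : E) r | ψ t x = 0} := ⟨hx, h0⟩
    rw [← hballs] at hx'
    exact hx'.1
  refine ⟨hfin.toFinset, hfin.coe_toFinset, ?_⟩
  have hS0 : (({0} : Finset E) : Set E) = {x ∈ Metric.ball (0 : E) r | ψ 0 x = 0} := by
    ext x
    simp only [Finset.coe_singleton, Set.mem_singleton_iff, Set.mem_ofPred_eq, hzero0]
    exact ⟨fun h => ⟨by simpa [h] using hr, h⟩, fun h => h.2⟩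
  have h2 : (2 : WithTop ℕ∞) ≤ ((⊤ : ℕ∞) : WithTop ℕ∞) :=
    WithTop.coe_le_coe.2 (le_top : (2 : ℕ∞) ≤ ⊤)
  rw [← sum_sign_det_fderiv_eq_of_segment_ne_zero (hsmooth0.of_le h2)
    ((hsmootht t ht.1).of_le h2) hr hne hS0 hfin.coe_toFinset (by simpa using hdet0.ne')
    (fun x hx => by
      rw [Set.Finite.mem_toFinset] at hx
      exact hreg x hx.1 hx.2)]
  simp [Real.sign_of_pos hdet0]
end
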